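/- arXiv:0909.0029 — 5 statements merged into one kernel-verified Lean document; each statement's English description precedes it below -/
import Mathlib

section
/- Let n₁, n₂ be nonnegative integers with n = n₁ + n₂ ≥ 1, and let R be an integer with 0 ≤ R ≤ n. Consider the hypergeometric distribution p(k) = C(n₂,k)·C(n₁,R−k)/C(n,R) for 0 ≤ k ≤ R, and let μ = R·n₂/n be its mean. Then either m = ⌊μ⌋ or m = ⌈μ⌉ is a median, i.e., there exists m ∈ {⌊μ⌋, ⌈μ⌉} such that Σ_{k=0}^{m} p(k) ≥ 1/2 and Σ_{k=m}^{R} p(k) ≥ 1/2. -/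
lemma hm_quad (b c A D x : ℝ) (hb : 0 ≤ b) (hc : 0 ≤ c) (hA : b ≤ A) (hD : b ≤ D)
    (hx : x ≤ b ^ 2) (hx0 : 0 ≤ x) (h : b * c ≤ A * D) :
    (b ^ 2 - x) * (c ^ 2 - x) ≤ (A ^ 2 - x) * (D ^ 2 - x) := by
  have h1 : (b * c) ^ 2 ≤ (A * D) ^ 2 := pow_le_pow_left₀ (by positivity) h 2
  have hA2 : b ^ 2 ≤ A ^ 2 := pow_le_pow_left₀ hb hA 2
  have hD2 : b ^ 2 ≤ D ^ 2 := pow_le_pow_left₀ hb hD 2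
  rcases le_total (A ^ 2 + D ^ 2) (b ^ 2 + c ^ 2) with h2 | h2
  · nlinarith [mul_nonneg hx0 (sub_nonneg.2 h2)]
  · nlinarith [mul_nonneg (sub_nonneg.2 hx) (sub_nonneg.2 h2),
      mul_nonneg (sub_nonneg.2 hA2) (sub_nonneg.2 hD2)]

lemma hm_step (U V U' V' p p' r r' : ℝ) (h1 : U * p = U' * r) (h2 : V * r' = V' * p')
    (h : U' ≤ V') (hp : 0 < p) (hp' : 0 < p') (hr : 0 ≤ r) (hV : 0 ≤ V)
    (hh : r * r' ≤ p * p') : U ≤ V := by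
  have : U * (p * p') ≤ V * (p * p') := by
    calc U * (p * p') = U' * (r * p') := by rw [← mul_assoc, h1]; ring
      _ ≤ V' * (r * p') := by gcongr
      _ = V * (r * r') := by linear_combination (-r) * h2
      _ ≤ V * (p * p') := by gcongr
  exact le_of_mul_le_mul_right this (by positivity)

lemma hm_cs (N k k' : ℕ) (hk : k' = k + 1) (hN : k ≤ N) (x y : ℝ) (hx : x = k + 1)
    (hy : y = N - k) : (N.choose k' : ℝ) * x = N.choose k * y := by
  subst hk hx hy
  have := Nat.choose_succ_right_eq N k
  rw [← Nat.cast_sub hN]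
  exact_mod_cast this

lemma hm_cu (N N' k : ℕ) (hk : N' = N + 1) (hN : k ≤ N) (x y : ℝ) (hx : x = N + 1 - k)
    (hy : y = N + 1) : (N'.choose k : ℝ) * x = N.choose k * y := by
  subst hk hx hy
  have := Nat.choose_mul_succ_eq N k
  have e : ((N : ℝ) + 1 - k) = ((N + 1 - k : ℕ) : ℝ) := by
    rw [Nat.cast_sub (by omega)]; push_cast; ring
  rw [e]
  exact_mod_cast this.symm

lemma hm_case1_term (a b c d : ℕ) (h : b * c ≤ a * d) (hm : min b c ≤ a) (hm' : min b c ≤ d)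
    (i : ℕ) (hi : i < b) (hi' : i < c) :
    ((a + c).choose (a + 1 + i) : ℝ) * (b + d).choose (b - 1 - i) ≤
      ((a + c).choose (c + i) : ℝ) * (b + d).choose (b + i) := by
  have hR : (b : ℝ) * c ≤ a * d := by exact_mod_cast h
  induction i with
  | zero =>
    have s1 : (a + c).choose c = (a + c).choose a := (Nat.choose_symm_add).symm
    simp only [add_zero, Nat.sub_zero]
    rw [s1]
    have e1 := hm_cs (a + c) a (a + 1) rfl (by omega) (a + 1) c (by simp) (by push_cast; ring)
    have e2 := hm_cs (b + d) (b - 1) b (by omega) (by omega) b (d + 1)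
      (by push_cast [show 1 ≤ b by omega]; ring) (by push_cast [show 1 ≤ b by omega]; ring)
    refine hm_step _ _ _ _ (a + 1) (d + 1) c b ?_ ?_
      (le_refl (((a + c).choose a : ℝ) * (b + d).choose (b - 1))) ?_ ?_ ?_ ?_ ?_
    · linear_combination ((b + d).choose (b - 1) : ℝ) * e1
    · linear_combination ((a + c).choose a : ℝ) * e2
    all_goals first | positivity | nlinarith
  | succ i ih =>
    have ih := ih (by omega) (by omega)
    have hia : i + 1 ≤ a := by omega
    have hid : i + 1 ≤ d := by omega
    have hia' : (i + 1 : ℝ) ≤ a := by exact_mod_cast hia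
    have hid' : (i + 1 : ℝ) ≤ d := by exact_mod_cast hid
    have hib' : (i + 1 : ℝ) ≤ b := by exact_mod_cast hi.le
    have hic' : (i + 1 : ℝ) ≤ c := by exact_mod_cast hi'.le
    have hb1 : ((b - 1 - (i + 1) : ℕ) : ℝ) = b - 1 - (i + 1) := by
      rw [Nat.sub_sub, Nat.cast_sub (by omega)]; push_cast; ring
    have e1 := hm_cs (a + c) (a + 1 + i) (a + 1 + (i + 1)) (by omega) (by omega)
      (a + 1 + (i + 1)) (c - (i + 1)) (by push_cast; ring) (by push_cast; ring)
    have e2 := hm_cs (b + d) (b - 1 - (i + 1)) (b - 1 - i) (by omega) (by omega)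
      (b - (i + 1)) (d + 1 + (i + 1)) (by rw [hb1]; ring) (by rw [hb1]; push_cast; ring)
    have e3 := hm_cs (a + c) (c + i) (c + (i + 1)) (by omega) (by omega)
      (c + (i + 1)) (a + 1 - (i + 1)) (by push_cast; ring) (by push_cast; ring)
    have e4 := hm_cs (b + d) (b + i) (b + (i + 1)) (by omega) (by omega)
      (b + (i + 1)) (d + 1 - (i + 1)) (by push_cast; ring) (by push_cast; ring)
    refine hm_step _ _ _ _ ((a + 1 + (i + 1)) * (d + 1 + (i + 1)))
      ((a + 1 - (i + 1)) * (d + 1 - (i + 1)))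
      ((c - (i + 1)) * (b - (i + 1))) ((c + (i + 1)) * (b + (i + 1))) ?_ ?_ ih ?_ ?_ ?_ ?_ ?_
    · rw [mul_mul_mul_comm, e1, ← e2]; ring
    · rw [mul_mul_mul_comm, e3, e4]; ring
    · positivity
    · exact mul_pos (by linarith) (by linarith)
    · exact mul_nonneg (by linarith) (by linarith)
    · positivity
    · rcases le_total b c with hbc | hbc
      · have h1 : (b : ℝ) ≤ a := by exact_mod_cast (show b ≤ a by omega)
        have h2 : (b : ℝ) ≤ d := by exact_mod_cast (show b ≤ d by omega)
        have := hm_quad b c (a + 1) (d + 1) ((i + 1) ^ 2) (by positivity) (by positivity)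
          (by linarith) (by linarith) (by gcongr) (by positivity) (by nlinarith)
        linarith
      · have h1 : (c : ℝ) ≤ a := by exact_mod_cast (show c ≤ a by omega)
        have h2 : (c : ℝ) ≤ d := by exact_mod_cast (show c ≤ d by omega)
        have := hm_quad c b (a + 1) (d + 1) ((i + 1) ^ 2) (by positivity) (by positivity)
          (by linarith) (by linarith) (by gcongr) (by positivity) (by nlinarith)
        linarith

def hmS (a b c d : ℕ) : ℕ :=
  ∑ i ∈ Finset.range (a + 1), (a + c).choose (c + i) * (b + d).choose (b + i)

lemma hmS_eq (a b c d : ℕ) :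
    hmS a b c d = ∑ k ∈ Finset.range (a + 1), (a + c).choose k * (b + d).choose (a + b - k) := by
  unfold hmS
  rw [← Finset.sum_range_reflect]
  refine Finset.sum_congr rfl fun k hk => ?_
  have hk := Finset.mem_range.1 hk
  rw [← Nat.choose_symm (show k ≤ a + c by omega)]
  congr 2 <;> omega

lemma hmS_comm (a b c d : ℕ) : hmS a b c d = hmS d c b a := by
  have key : ∀ a b c d : ℕ, hmS a b c d =
      ∑ i ∈ Finset.range (a + d + 1), (a + c).choose (c + i) * (b + d).choose (b + i) := by
    intro a b c d
    unfold hmS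
    apply Finset.sum_subset
    · intro x; simp only [Finset.mem_range]; omega
    · intro x _ hx
      simp only [Finset.mem_range] at hx
      rw [Nat.choose_eq_zero_of_lt (show a + c < c + x by omega), zero_mul]
  rw [key, key d c b a, Nat.add_comm d a]
  refine Finset.sum_congr rfl fun k _ => ?_
  rw [mul_comm, Nat.add_comm b d, Nat.add_comm a c]

lemma hm_vand (N M R : ℕ) :
    (N + M).choose R = ∑ k ∈ Finset.range (R + 1), N.choose k * M.choose (R - k) := by
  rw [Nat.add_choose_eq, Finset.Nat.sum_antidiagonal_eq_sum_range_succ_mk]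

lemma hm_case1 (a b c d : ℕ) (h : b * c ≤ a * d) (hm : min b c ≤ a) (hm' : min b c ≤ d) :
    (a + b + c + d).choose (a + b) ≤ 2 * hmS a b c d := by
  rw [show a + b + c + d = (a + c) + (b + d) by ring, hm_vand,
    show a + b + 1 = (a + 1) + b by ring, Finset.sum_range_add, ← hmS_eq, two_mul]
  gcongr
  have h1 : ∑ x ∈ Finset.range b, (a + c).choose (a + 1 + x) * (b + d).choose (a + b - (a + 1 + x))
      = ∑ x ∈ Finset.range (min b c),
        (a + c).choose (a + 1 + x) * (b + d).choose (a + b - (a + 1 + x)) := by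
    symm
    apply Finset.sum_subset
    · intro x; simp only [Finset.mem_range]; omega
    · intro x hx hx'
      simp only [Finset.mem_range] at hx hx'
      rw [Nat.choose_eq_zero_of_lt (show a + c < a + 1 + x by omega), zero_mul]
  rw [h1]
  calc _ ≤ ∑ i ∈ Finset.range (min b c), (a + c).choose (c + i) * (b + d).choose (b + i) := by
        refine Finset.sum_le_sum fun i hi => ?_
        have hi := Finset.mem_range.1 hi
        have := hm_case1_term a b c d h hm hm' i (by omega) (by omega)
        rw [show a + b - (a + 1 + i) = b - 1 - i by omega]
        exact_mod_cast this
    _ ≤ _ := by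
        unfold hmS
        apply Finset.sum_le_sum_of_subset
        intro x; simp only [Finset.mem_range]; omega

/-- waiting-time comparison -/
lemma hm_case2_term (a b c d : ℕ) (h : b * c ≤ a * d) (hb : a < b) (hc : a < c) (hcd : c ≤ d)
    (j : ℕ) (hj : j < c) :
    ((a + c - 1 - j).choose a : ℝ) * (b + d + j).choose (b - 1) ≤
      ((a + c + j).choose a : ℝ) * (b + d - 1 - j).choose (b - 1) := by
  have hR : (b : ℝ) * c ≤ a * d := by exact_mod_cast h
  have hcd' : (c : ℝ) ≤ d := by exact_mod_cast hcd
  have hb' : ((b - 1 : ℕ) : ℝ) = b - 1 := by rw [Nat.cast_sub (by omega)]; simp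
  induction j with
  | zero =>
    simp only [add_zero, Nat.sub_zero]
    have e1 := hm_cu (a + c - 1) (a + c) a (by omega) (by omega) c (a + c)
      (by rw [Nat.cast_sub (by omega)]; push_cast; ring)
      (by rw [Nat.cast_sub (by omega)]; push_cast; ring)
    have e2 := hm_cu (b + d - 1) (b + d) (b - 1) (by omega) (by omega) (d + 1) (b + d)
      (by rw [hb', Nat.cast_sub (by omega)]; push_cast; ring)
      (by rw [Nat.cast_sub (by omega)]; push_cast; ring)
    refine hm_step _ _ _ _ (d + 1) (a + c) (b + d) c ?_ ?_
      (le_refl (((a + c - 1).choose a : ℝ) * (b + d - 1).choose (b - 1))) ?_ ?_ ?_ ?_ ?_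
    · rw [mul_assoc, e2]; ring
    · rw [mul_right_comm, e1]; ring
    · positivity
    · exact_mod_cast (show 0 < a + c by omega)
    · positivity
    · positivity
    · nlinarith
  | succ i ih =>
    have ih := ih (by omega)
    have hic : (i + 1 : ℝ) < c := by exact_mod_cast hj
    have ha0 : (0 : ℝ) ≤ a := by positivity
    have hb0 : (0 : ℝ) ≤ b := by positivity
    have hi0 : (0 : ℝ) ≤ i := by positivity
    have hc1 : ((a + c - 1 - (i + 1) : ℕ) : ℝ) = a + c - 1 - (i + 1) := by
      rw [Nat.sub_sub, Nat.cast_sub (by omega)]; push_cast; ring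
    have hd1 : ((b + d - 1 - (i + 1) : ℕ) : ℝ) = b + d - 1 - (i + 1) := by
      rw [Nat.sub_sub, Nat.cast_sub (by omega)]; push_cast; ring
    have e1 := hm_cu (a + c - 1 - (i + 1)) (a + c - 1 - i) a (by omega) (by omega)
      (c - (i + 1)) (a + c - (i + 1)) (by rw [hc1]; ring) (by rw [hc1]; ring)
    have e2 := hm_cu (b + d + i) (b + d + (i + 1)) (b - 1) (by omega) (by omega)
      (d + 1 + (i + 1)) (b + d + (i + 1)) (by rw [hb']; push_cast; ring) (by push_cast; ring)
    have e3 := hm_cu (a + c + i) (a + c + (i + 1)) a (by omega) (by omega)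
      (c + (i + 1)) (a + c + (i + 1)) (by push_cast; ring) (by push_cast; ring)
    have e4 := hm_cu (b + d - 1 - (i + 1)) (b + d - 1 - i) (b - 1) (by omega) (by omega)
      (d + 1 - (i + 1)) (b + d - (i + 1)) (by rw [hb', hd1]; ring) (by rw [hd1]; ring)
    refine hm_step _ _ _ _ ((a + c - (i + 1)) * (d + 1 + (i + 1)))
      ((a + c + (i + 1)) * (d + 1 - (i + 1)))
      ((c - (i + 1)) * (b + d + (i + 1))) ((c + (i + 1)) * (b + d - (i + 1)))
      ?_ ?_ ih ?_ ?_ ?_ ?_ ?_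
    · rw [mul_mul_mul_comm, e2, ← e1]; ring
    · rw [mul_mul_mul_comm, e3, ← e4]; ring
    · exact mul_pos (by linarith) (by linarith)
    · exact mul_pos (by linarith) (by linarith)
    · exact mul_nonneg (by linarith) (by linarith)
    · positivity
    · have := hm_quad c (b + d) (a + c) (d + 1) ((i + 1) ^ 2) (by positivity) (by positivity)
        (by linarith) (by linarith) (by gcongr) (by positivity) (by nlinarith)
      linarith

lemma hm_F (t s a b : ℕ) (hb : 1 ≤ b) :
    ∑ k ∈ Finset.range (a + 1), t.choose k * (s + 1).choose (a + b - k) =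
    ∑ k ∈ Finset.range (a + 1), (t + 1).choose k * s.choose (a + b - k) +
      t.choose a * s.choose (b - 1) := by
  have h1 : ∑ k ∈ Finset.range (a + 1), t.choose k * (s + 1).choose (a + b - k) =
      ∑ k ∈ Finset.range (a + 1), t.choose k * s.choose (a + b - k) +
      ∑ k ∈ Finset.range (a + 1), t.choose k * s.choose (a + b - k - 1) := by
    rw [← Finset.sum_add_distrib]
    refine Finset.sum_congr rfl fun k hk => ?_
    have hk := Finset.mem_range.1 hk
    obtain ⟨e, he⟩ : ∃ e, a + b - k = e + 1 := ⟨a + b - k - 1, by omega⟩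
    rw [he, Nat.choose_succ_succ]
    simp only [Nat.add_sub_cancel, Nat.succ_eq_add_one]
    ring
  rw [h1, Finset.sum_range_succ (fun k => t.choose k * s.choose (a + b - k - 1)),
    show a + b - a - 1 = b - 1 by omega, ← add_assoc]
  congr 1
  rw [Finset.sum_range_succ' _ a, Finset.sum_range_succ' _ a]
  simp only [Nat.choose_succ_succ, Nat.choose_zero_right, Nat.succ_eq_add_one, add_mul,
    Finset.sum_add_distrib, Nat.sub_sub]
  ring

lemma hm_case2 (a b c d : ℕ) (h : b * c ≤ a * d) (hb : a < b) (hc : a < c) :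
    (a + b + c + d).choose (a + b) ≤ 2 * hmS a b c d := by
  have hcd : c ≤ d := by
    by_contra hlt
    push Not at hlt
    nlinarith
  let F : ℕ → ℕ → ℕ := fun t s =>
    ∑ k ∈ Finset.range (a + 1), t.choose k * s.choose (a + b - k)
  have hF : ∀ t s, F t (s + 1) = F (t + 1) s + t.choose a * s.choose (b - 1) :=
    fun t s => hm_F t s a b (by omega)
  have key : ∀ j, j ≤ c → F (a + c - j) (b + d + j) + F (a + c + j) (b + d - j) ≤
      2 * F (a + c) (b + d) := by
    intro j
    induction j with
    | zero => intro _; simp [two_mul]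
    | succ j ih =>
      intro hj
      have ih := ih (by omega)
      have t := hm_case2_term a b c d h hb hc hcd j (by omega)
      have t' : (a + c - 1 - j).choose a * (b + d + j).choose (b - 1) ≤
        (a + c + j).choose a * (b + d - 1 - j).choose (b - 1) := by exact_mod_cast t
      have f1 := hF (a + c - 1 - j) (b + d + j)
      have f2 := hF (a + c + j) (b + d - 1 - j)
      rw [show a + c - 1 - j + 1 = a + c - j by omega] at f1
      rw [show b + d - 1 - j + 1 = b + d - j by omega] at f2
      rw [show a + c - (j + 1) = a + c - 1 - j by omega,
        show b + d - (j + 1) = b + d - 1 - j by omega,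
        show b + d + (j + 1) = b + d + j + 1 by omega,
        show a + c + (j + 1) = a + c + j + 1 by omega]
      omega
  have k := key c le_rfl
  rw [hmS_eq]
  have tot : F (a + c - c) (b + d + c) = (a + b + c + d).choose (a + b) := by
    rw [show a + b + c + d = a + (b + d + c) by ring, hm_vand, Nat.add_sub_cancel]
    apply Finset.sum_subset
    · intro x; simp only [Finset.mem_range]; omega
    · intro x _ hx
      simp only [Finset.mem_range] at hx
      rw [Nat.choose_eq_zero_of_lt (show a < x by omega), zero_mul]
  rw [← tot]
  exact le_trans (Nat.le_add_right _ _) k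

lemma hm_main (a b c d : ℕ) (h : b * c ≤ a * d) :
    (a + b + c + d).choose (a + b) ≤ 2 * hmS a b c d := by
  by_cases h1 : a < b ∧ a < c
  · exact hm_case2 a b c d h h1.1 h1.2
  by_cases h2 : d < b ∧ d < c
  · rw [hmS_comm]
    have := hm_case2 d c b a (by linarith [mul_comm b c, mul_comm a d]) h2.2 h2.1
    rwa [show d + c + b + a = a + b + c + d by ring,
      Nat.choose_symm_of_eq_add (show a + b + c + d = (d + c) + (a + b) by ring)] at this
  exact hm_case1 a b c d h (by omega) (by omega)

lemma hm_lower (n₁ n₂ R m : ℕ) (h1 : m ≤ R) (h2 : m ≤ n₂) (h3 : R ≤ n₁ + m)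
    (h : R * n₂ ≤ m * (n₁ + n₂)) :
    (n₁ + n₂).choose R ≤
      2 * ∑ k ∈ Finset.range (m + 1), n₂.choose k * n₁.choose (R - k) := by
  obtain ⟨b, rfl⟩ := Nat.exists_eq_add_of_le h1
  obtain ⟨c, rfl⟩ := Nat.exists_eq_add_of_le h2
  obtain ⟨d, rfl⟩ := Nat.exists_eq_add_of_le (show b ≤ n₁ by omega)
  have := hm_main m b c d (by nlinarith)
  rw [hmS_eq] at this
  rwa [show b + d + (m + c) = m + b + c + d by ring]

lemma hm_upper (n₁ n₂ R m : ℕ) (h1 : m ≤ R) (h2 : m ≤ n₂) (h3 : R ≤ n₁ + m)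
    (h : m * (n₁ + n₂) ≤ R * n₂) :
    (n₁ + n₂).choose R ≤
      2 * ∑ k ∈ Finset.Icc m R, n₂.choose k * n₁.choose (R - k) := by
  obtain ⟨b, rfl⟩ := Nat.exists_eq_add_of_le h1
  have := hm_lower n₂ n₁ (m + b) b (by omega) (by omega) (by omega) (by nlinarith)
  rw [Nat.add_comm n₂ n₁] at this
  convert this using 2
  rw [← Finset.sum_range_reflect, ← Finset.Ico_succ_right_eq_Icc, Finset.sum_Ico_eq_sum_range]
  rw [show Order.succ (m + b) - m = b + 1 by simp; omega]
  refine Finset.sum_congr rfl fun k hk => ?_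
  have hk := Finset.mem_range.1 hk
  rw [mul_comm]
  congr 2 <;> omega

theorem hypergeometric_median (n₁ n₂ R : ℕ) (hn : 1 ≤ n₁ + n₂) (hR : R ≤ n₁ + n₂) :
    ∃ m : ℕ,
      (m = ⌊(R * n₂ : ℝ) / (n₁ + n₂)⌋₊ ∨ m = ⌈(R * n₂ : ℝ) / (n₁ + n₂)⌉₊) ∧
      (1 : ℝ) / 2 ≤ ∑ k ∈ Finset.range (m + 1),
          (n₂.choose k * n₁.choose (R - k) : ℝ) / ((n₁ + n₂).choose R) ∧
      (1 : ℝ) / 2 ≤ ∑ k ∈ Finset.Icc m R,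
          (n₂.choose k * n₁.choose (R - k) : ℝ) / ((n₁ + n₂).choose R) := by
  have hnR : (0 : ℝ) < n₁ + n₂ := by exact_mod_cast hn
  have hC : (0 : ℝ) < (n₁ + n₂).choose R := by exact_mod_cast Nat.choose_pos hR
  have conv : ∀ s : Finset ℕ, (n₁ + n₂).choose R ≤
      2 * ∑ k ∈ s, n₂.choose k * n₁.choose (R - k) →
      (1 : ℝ) / 2 ≤ ∑ k ∈ s,
          (n₂.choose k * n₁.choose (R - k) : ℝ) / ((n₁ + n₂).choose R) := by
    intro s hs
    rw [← Finset.sum_div, le_div_iff₀ hC]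
    have : ((n₁ + n₂).choose R : ℝ) ≤ 2 * ∑ k ∈ s, (n₂.choose k * n₁.choose (R - k) : ℝ) := by
      exact_mod_cast hs
    linarith
  set μ : ℝ := (R * n₂ : ℝ) / (n₁ + n₂) with hμ
  have hμ0 : 0 ≤ μ := by positivity
  have hμn : μ * (n₁ + n₂) = R * n₂ := by rw [hμ]; field_simp
  have hRr : (R : ℝ) ≤ n₁ + n₂ := by exact_mod_cast hR
  have hR0 : (0 : ℝ) ≤ R := by positivity
  have h10 : (0 : ℝ) ≤ n₁ := by positivity
  have h20 : (0 : ℝ) ≤ n₂ := by positivity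
  have b1 : μ ≤ R := by rw [hμ, div_le_iff₀ hnR]; nlinarith
  have b2 : μ ≤ n₂ := by rw [hμ, div_le_iff₀ hnR]; nlinarith
  have b3 : R - n₁ ≤ μ := by rw [hμ, le_div_iff₀ hnR]; nlinarith
  have hfl : (⌊μ⌋₊ : ℝ) ≤ μ := Nat.floor_le hμ0
  have hce : μ ≤ (⌈μ⌉₊ : ℝ) := Nat.le_ceil μ
  have f1 : ⌊μ⌋₊ ≤ R := by exact_mod_cast hfl.trans b1
  have f2 : ⌊μ⌋₊ ≤ n₂ := by exact_mod_cast hfl.trans b2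
  have f3 : R ≤ n₁ + ⌊μ⌋₊ := by
    by_contra hlt
    push Not at hlt
    have h1 : ((R - n₁ : ℕ) : ℝ) ≤ μ := by rw [Nat.cast_sub (by omega)]; exact b3
    have := Nat.le_floor h1
    omega
  have c1 : ⌈μ⌉₊ ≤ R := Nat.ceil_le.2 b1
  have c2 : ⌈μ⌉₊ ≤ n₂ := Nat.ceil_le.2 b2
  have fc : ⌊μ⌋₊ ≤ ⌈μ⌉₊ := Nat.floor_le_ceil μ
  have cf : ⌈μ⌉₊ ≤ ⌊μ⌋₊ + 1 := Nat.ceil_le_floor_add_one μ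
  have up := hm_upper n₁ n₂ R ⌊μ⌋₊ f1 f2 f3 (by
    have : (⌊μ⌋₊ : ℝ) * (n₁ + n₂) ≤ R * n₂ := by rw [← hμn]; gcongr
    exact_mod_cast this)
  have lo := hm_lower n₁ n₂ R ⌈μ⌉₊ c1 c2 (by omega) (by
    have : (R : ℝ) * n₂ ≤ (⌈μ⌉₊ : ℝ) * (n₁ + n₂) := by rw [← hμn]; gcongr
    exact_mod_cast this)
  rcases fc.eq_or_lt with he | hl
  · exact ⟨⌊μ⌋₊, Or.inl rfl, conv _ (by rwa [he]), conv _ up⟩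
  have he : ⌈μ⌉₊ = ⌊μ⌋₊ + 1 := by omega
  have tot := hm_vand n₂ n₁ R
  rw [Nat.add_comm n₂ n₁, ← Finset.sum_range_add_sum_Ico _ (show ⌊μ⌋₊ + 1 ≤ R + 1 by omega),
    show Finset.Ico (⌊μ⌋₊ + 1) (R + 1) = Finset.Icc (⌊μ⌋₊ + 1) R from rfl] at tot
  rcases le_total (∑ k ∈ Finset.Icc (⌊μ⌋₊ + 1) R, n₂.choose k * n₁.choose (R - k))
    (∑ k ∈ Finset.range (⌊μ⌋₊ + 1), n₂.choose k * n₁.choose (R - k)) with hh | hh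
  · exact ⟨⌊μ⌋₊, Or.inl rfl, conv _ (by omega), conv _ up⟩
  · exact ⟨⌈μ⌉₊, Or.inr rfl, conv _ lo, conv _ (by rw [he]; omega)⟩
end

section
/- Fix f ∈ (0,1/2) and sequences of positive integers n₁ = n₁(n), n₂ = n₂(n) with n₁(n) + n₂(n) = n and n₁(n) → ∞, n₂(n) → ∞. Then there exist functions h : ℕ → ℕ with h(n) → ∞ and ε : ℕ → ℝ with ε(n) → 0 such that for every n and every integer r with f·n₂ − h(n) ≤ r ≤ f·n₂, setting R = ⌊f·n₁⌋ + r: Σ_{k=0}^{r} C(n₂,k)·C(n₁,R−k) ≥ (1/2 − ε(n))·C(n,R). Equivalently, if X is the number of marked elements when R elements are drawn uniformly without replacement from a set of n = n₁ + n₂ elements of which n₂ are marked, then Pr(X ≤ r) ≥ 1/2 − ε(n). -/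
open Filter

/-- The weights. -/
noncomputable def hgP (N1 N2 R k : ℕ) : ℝ :=
  if k ≤ R then (N2.choose k : ℝ) * (N1.choose (R - k) : ℝ) else 0

lemma hgP_nonneg (N1 N2 R k : ℕ) : 0 ≤ hgP N1 N2 R k := by
  unfold hgP; split_ifs <;> positivity

lemma hgP_zero (N1 N2 R k : ℕ) (h : R < k) : hgP N1 N2 R k = 0 := by
  unfold hgP; rw [if_neg (by omega)]

lemma hgP_zero' (N1 N2 R k : ℕ) (h : N2 < k) : hgP N1 N2 R k = 0 := by
  unfold hgP; simp [Nat.choose_eq_zero_of_lt h]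

lemma choose_succ_real (n k : ℕ) :
    (n.choose (k+1) : ℝ) * (k+1) = n.choose k * ((n:ℝ) - k) := by
  have h := Nat.choose_succ_right_eq n k
  rcases le_or_gt k n with hk | hk
  · have h' : ((n.choose (k+1) * (k+1) : ℕ) : ℝ) = ((n.choose k * (n-k) : ℕ) : ℝ) := by rw [h]
    push_cast [Nat.cast_sub hk] at h'
    exact h'
  · rw [Nat.choose_eq_zero_of_lt hk, Nat.choose_eq_zero_of_lt (by omega : n < k+1)]; simp

lemma hgP_succ (N1 N2 R k : ℕ) :
    hgP N1 N2 R (k+1) * ((k+1) * ((N1:ℝ) - R + k + 1)) =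
      hgP N1 N2 R k * (((N2:ℝ) - k) * ((R:ℝ) - k)) := by
  rcases lt_or_ge k R with hk | hk
  · unfold hgP
    rw [if_pos (by omega : k+1 ≤ R), if_pos hk.le]
    obtain ⟨d, rfl⟩ : ∃ d, R = k + 1 + d := ⟨R - (k+1), by omega⟩
    rw [show k + 1 + d - (k+1) = d by omega, show k + 1 + d - k = d + 1 by omega]
    have h1 := choose_succ_real N2 k
    have h2 := choose_succ_real N1 d
    push_cast
    linear_combination (N1.choose d : ℝ) * ((N1:ℝ) - d) * h1 - (N2.choose k : ℝ) * ((N2:ℝ) - k) * h2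
  · rw [hgP_zero _ _ _ (k+1) (by omega)]
    rcases eq_or_lt_of_le hk with h | h
    · subst h; simp
    · rw [hgP_zero _ _ _ k h]; simp

lemma hgP_total (N1 N2 R : ℕ) :
    ((N1 + N2).choose R : ℝ) = ∑ k ∈ Finset.range (R+1), hgP N1 N2 R k := by
  rw [add_comm, Nat.add_choose_eq, Finset.Nat.sum_antidiagonal_eq_sum_range_succ_mk]
  push_cast
  apply Finset.sum_congr rfl
  intro k hk
  have := Finset.mem_range.1 hk
  unfold hgP; rw [if_pos (by omega)]

lemma pair_alg (A B C D i J g M H q : ℝ) (hg0 : 0 ≤ g) (hg1 : g ≤ 1) (hB : B ≤ g * D)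
    (hA : g * A ≤ M + H) (hC : M - H ≤ C) (hMH : 0 < M - H) (hi0 : 0 < i) (hiJ : i ≤ J)
    (hAi : i ≤ A) (hBi : i ≤ B) (hCi : i ≤ C) (hDi : i ≤ D)
    (hq : (M+H)^2 ≤ q * ((M-H)^2 - J^2)) (hq1 : 1 ≤ q) :
    (A^2 - i^2) * (B^2-i^2) ≤ q * ((C^2-i^2)*(D^2-i^2)) := by
  have hD2 : 0 ≤ D^2 - i^2 := sub_nonneg.2 (pow_le_pow_left₀ hi0.le hDi 2)
  have hA2 : 0 ≤ A^2 - i^2 := sub_nonneg.2 (pow_le_pow_left₀ hi0.le hAi 2)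
  have hgg : g^2 ≤ 1 := pow_le_one₀ hg0 hg1
  have h1 : B^2 - i^2 ≤ g^2 * (D^2-i^2) := by
    have e : B^2 ≤ (g*D)^2 := pow_le_pow_left₀ (by linarith) hB 2
    have e2 : g^2 * i^2 ≤ i^2 := mul_le_of_le_one_left (sq_nonneg i) hgg
    calc B^2 - i^2 ≤ (g*D)^2 - g^2 * i^2 := by linarith
      _ = _ := by ring
  have h2 : g^2 * (A^2-i^2) ≤ q * (C^2-i^2) := by
    have e : (g*A)^2 ≤ (M+H)^2 := pow_le_pow_left₀ (mul_nonneg hg0 (by linarith)) hA 2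
    have c1 : (M-H)^2 ≤ C^2 := pow_le_pow_left₀ hMH.le hC 2
    have c2 : i^2 ≤ J^2 := pow_le_pow_left₀ hi0.le hiJ 2
    have h4 : q * ((M-H)^2 - J^2) ≤ q * (C^2-i^2) := by
      apply mul_le_mul_of_nonneg_left <;> linarith
    have e2 : 0 ≤ (g*i)^2 := sq_nonneg _
    calc g^2 * (A^2-i^2) = (g*A)^2 - (g*i)^2 := by ring
      _ ≤ _ := by linarith
  calc _ ≤ (A^2 - i^2) * (g^2 * (D^2-i^2)) :=
        mul_le_mul_of_nonneg_left h1 hA2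
    _ = (g^2 * (A^2-i^2)) * (D^2-i^2) := by ring
    _ ≤ (q * (C^2-i^2)) * (D^2-i^2) := mul_le_mul_of_nonneg_right h2 hD2
    _ = _ := by ring

lemma q_alg (f x M q : ℝ) (hf0 : 0 < f) (hf1 : f < 1/2) (hx : 4 ≤ x) (hM1 : f * x^5 ≤ M)
    (hM3 : 8 * x^3 ≤ M) (hx3 : 16 * x ≤ x^3) (hq : q = 1 + 16/(f^2*x^4)) :
    (M+x)^2 ≤ q * ((M-x)^2 - (2*x^3)^2) := by
  have hM0 : 0 < M := by linarith
  have e1 : M^2/2 ≤ (M-x)^2 - (2*x^3)^2 := by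
    have a1 : (8*x^3)^2 ≤ M^2 := pow_le_pow_left₀ (by positivity) hM3 2
    have a2 : M * (128 * x) ≤ M * M := mul_le_mul_of_nonneg_left (by linarith) hM0.le
    nlinarith [sq_nonneg x]
  have e2 : 4*M*x + 4*x^6 ≤ 16/(f^2*x^4) * (M^2/2) := by
    rw [div_mul_eq_mul_div, le_div_iff₀ (by positivity)]
    have i1 : f * x^5 * (f * x^5) ≤ M * M := by gcongr
    have i3 : M * (f * x^5) * f ≤ M * M * 1 := by gcongr; linarith
    have : (4*M*x + 4*x^6) * (f^2*x^4) = 4 * (M * (f * x^5) * f) + 4 * (f * x^5 * (f * x^5)) := by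
      ring
    rw [this]
    nlinarith
  have e3 : 16/(f^2*x^4) * (M^2/2) ≤ 16/(f^2*x^4) * ((M-x)^2 - (2*x^3)^2) := by
    gcongr
  calc (M+x)^2 = ((M-x)^2 - (2*x^3)^2) + (4*M*x + 4*x^6) := by ring
    _ ≤ ((M-x)^2 - (2*x^3)^2) + 16/(f^2*x^4) * ((M-x)^2 - (2*x^3)^2) := by linarith
    _ = _ := by rw [hq]; ring

/-- Pairing step. -/
lemma pair_bound (N1 N2 a r J : ℕ) (g M H q : ℝ) (hg0 : 0 ≤ g) (hg1 : g ≤ 1)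
    (hB : (a:ℝ) ≤ g * ((N1:ℝ) - a + 1)) (haN : a ≤ N1)
    (hA : g * ((N2:ℝ) - r) ≤ M + H) (hC : M - H ≤ (r:ℝ) + 1) (hMH : 0 < M - H) (hH : 0 ≤ H)
    (hJA : (J:ℝ) ≤ (N2:ℝ) - r) (hJC : (J:ℝ) < M - H) (hJr : J ≤ r)
    (hq : (M+H)^2 ≤ q * ((M-H)^2 - (J:ℝ)^2)) (j : ℕ) (hj : j < J) (hja : j + 1 ≤ a) :
    hgP N1 N2 (a+r) (r+1+j) ≤ q^(j+1) * hgP N1 N2 (a+r) (r-j) := by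
  have hJ2 : 0 < (M-H)^2 - (J:ℝ)^2 := by
    have : (0:ℝ) ≤ J := by positivity
    nlinarith
  have hq1 : 1 ≤ q := by
    by_contra h
    push Not at h
    nlinarith [sq_nonneg (J:ℝ)]
  have haN' : (a:ℝ) ≤ N1 := by exact_mod_cast haN
  induction j with
  | zero =>
    have h := hgP_succ N1 N2 (a+r) r
    push_cast at h
    have hp := hgP_nonneg N1 N2 (a+r) r
    have hp1 := hgP_nonneg N1 N2 (a+r) (r+1)
    simp only [add_zero, zero_add, pow_one, Nat.sub_zero]
    have hD : (0:ℝ) < (N1:ℝ) - a + 1 := by linarith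
    have hCD : (0:ℝ) < ((r:ℝ)+1) * ((N1:ℝ) - a + 1) := by positivity
    refine le_of_mul_le_mul_right ?_ hCD
    have hA0 : (0:ℝ) ≤ (N2:ℝ) - r := le_trans (by positivity) hJA
    have key : ((N2:ℝ) - r) * a ≤ q * (((r:ℝ)+1) * ((N1:ℝ) - a + 1)) := by
      have h1 : ((N2:ℝ) - r) * a ≤ (M+H) * ((N1:ℝ) - a + 1) := by
        calc ((N2:ℝ) - r) * a ≤ ((N2:ℝ) - r) * (g * ((N1:ℝ) - a + 1)) := by gcongr
          _ = (g * ((N2:ℝ) - r)) * ((N1:ℝ) - a + 1) := by ring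
          _ ≤ _ := by gcongr
      have h2 : M + H ≤ q * (r+1) := by
        have : M + H ≤ q * (M-H) := by
          by_contra hc
          push Not at hc
          have : q * (M-H) * (M-H) < (M+H) * (M+H) := by nlinarith
          nlinarith [mul_nonneg (by linarith : (0:ℝ) ≤ q) (sq_nonneg (J:ℝ))]
        nlinarith
      nlinarith
    calc _ = hgP N1 N2 (a+r) r * (((N2:ℝ) - r) * a) := by
          linear_combination h
      _ ≤ hgP N1 N2 (a+r) r * (q * (((r:ℝ)+1) * ((N1:ℝ) - a + 1))) := by gcongr
      _ = _ := by ring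
  | succ j ih =>
    have ih := ih (by omega) (by omega)
    obtain ⟨s, hs⟩ : ∃ s, r = s + (j+1) := ⟨r - (j+1), by omega⟩
    have e1 : r - (j+1) = s := by omega
    have e2 : r - j = s + 1 := by omega
    rw [e2] at ih
    rw [e1]
    have hu := hgP_succ N1 N2 (a+r) (r+1+j)
    have hd := hgP_succ N1 N2 (a+r) s
    have hsr : (s:ℝ) = r - (j+1) := by rw [hs]; push_cast; ring
    rw [show r + 1 + (j+1) = r+1+j+1 by ring]
    have hp0 := hgP_nonneg N1 N2 (a+r) s
    have hp1 := hgP_nonneg N1 N2 (a+r) (s+1)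
    have hp2 := hgP_nonneg N1 N2 (a+r) (r+1+j)
    generalize hgP N1 N2 (a+r) (r+1+j+1) = p3 at *
    generalize hgP N1 N2 (a+r) (r+1+j) = p2 at *
    generalize hgP N1 N2 (a+r) (s+1) = p1 at *
    generalize hgP N1 N2 (a+r) s = p0 at *
    push_cast at hu hd
    rw [hsr] at hd
    obtain ⟨i, hi⟩ : ∃ i : ℝ, i = (j:ℝ) + 1 := ⟨_, rfl⟩
    have hi0 : 0 < i := by rw [hi]; positivity
    have hiJ : i ≤ J := by rw [hi]; exact_mod_cast hj.le
    have hia : i ≤ a := by rw [hi]; exact_mod_cast (by omega : j + 1 ≤ a)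
    obtain ⟨A, hAd⟩ : ∃ A : ℝ, A = (N2:ℝ) - r := ⟨_, rfl⟩
    obtain ⟨C, hCd⟩ : ∃ C : ℝ, C = (r:ℝ) + 1 := ⟨_, rfl⟩
    obtain ⟨D, hDd⟩ : ∃ D : ℝ, D = (N1:ℝ) - a + 1 := ⟨_, rfl⟩
    obtain ⟨B, hBd⟩ : ∃ B : ℝ, B = (a:ℝ) := ⟨_, rfl⟩
    have hu' : p3 * ((C+i)*(D+i)) = p2 * ((A-i)*(B-i)) := by
      rw [hi, hAd, hCd, hDd, hBd]; linear_combination hu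
    have hd' : p1 * ((C-i)*(D-i)) = p0 * ((A+i)*(B+i)) := by
      rw [hi, hAd, hCd, hDd, hBd]; linear_combination hd
    rw [← hAd] at hA hJA
    rw [← hCd] at hC
    rw [← hDd, ← hBd] at hB
    rw [← hBd] at hia
    have hia' : i + 1 ≤ B := by rw [hi, hBd]; exact_mod_cast hja
    have hD1 : 1 ≤ D := by rw [hDd]; linarith
    have hBD : B ≤ D := hB.trans (mul_le_of_le_one_left (by linarith) hg1)
    have hCi : 0 < C - i := by linarith
    have hDi : 0 < D - i := by linarith
    have hAi : 0 ≤ A - i := by linarith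
    have hBi : 0 ≤ B - i := by linarith
    have key : (A^2 - i^2) * (B^2-i^2) ≤ q * ((C^2-i^2)*(D^2-i^2)) :=
      pair_alg A B C D i J g M H q hg0 hg1 hB hA hC hMH hi0 hiJ (by linarith) (by linarith)
        (by linarith) (by linarith) hq hq1
    have hpos : 0 < ((C+i)*(D+i)) * ((C-i)*(D-i)) := by
      have : 0 < C + i := by linarith
      have : 0 < D + i := by linarith
      positivity
    refine le_of_mul_le_mul_right ?_ hpos
    have hqn : 0 ≤ q^(j+1) := by positivity
    calc p3 * (((C+i)*(D+i)) * ((C-i)*(D-i))) = p2 * (((A-i)*(B-i)) * ((C-i)*(D-i))) := by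
          linear_combination ((C-i)*(D-i)) * hu'
      _ ≤ (q^(j+1) * p1) * (((A-i)*(B-i)) * ((C-i)*(D-i))) := by
          apply mul_le_mul_of_nonneg_right ih; positivity
      _ = q^(j+1) * p0 * ((A^2 - i^2) * (B^2-i^2)) := by
          linear_combination q^(j+1) * ((A-i)*(B-i)) * hd'
      _ ≤ q^(j+1) * p0 * (q * ((C^2-i^2)*(D^2-i^2))) := by
          apply mul_le_mul_of_nonneg_left key; positivity
      _ = _ := by ring

lemma tail_step (N1 N2 a r L : ℕ) (g M H : ℝ) (hg0 : 0 ≤ g)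
    (hB : (a:ℝ) ≤ g * ((N1:ℝ) - a + 1)) (haN : a ≤ N1)
    (hA : g * ((N2:ℝ) - r) ≤ M + H) (hC : M - H ≤ (r:ℝ) + 1) (hMH : 0 < M - H)
    (hMH' : 0 ≤ M + H)
    (i : ℕ) (hi : L ≤ i) :
    hgP N1 N2 (a+r) (r+i+1) ≤ (M+H)/(M-H+L) * hgP N1 N2 (a+r) (r+i) := by
  have hL : (0:ℝ) ≤ L := by positivity
  have hiL : (L:ℝ) ≤ i := by exact_mod_cast hi
  have ht : 0 ≤ (M+H)/(M-H+L) := by apply div_nonneg hMH'; linarith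
  have hp := hgP_nonneg N1 N2 (a+r) (r+i)
  have hp1 := hgP_nonneg N1 N2 (a+r) (r+i+1)
  rcases le_or_gt a i with h | h
  · rw [hgP_zero _ _ _ (r+i+1) (by omega)]; positivity
  rcases le_or_gt N2 (r+i) with h2 | h2
  · rw [hgP_zero' _ _ _ (r+i+1) (by omega)]; positivity
  have hu := hgP_succ N1 N2 (a+r) (r+i)
  generalize hgP N1 N2 (a+r) (r+i+1) = p1 at *
  generalize hgP N1 N2 (a+r) (r+i) = p0 at *
  push_cast at hu
  have haN' : (a:ℝ) ≤ N1 := by exact_mod_cast haN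
  have h2' : (r:ℝ) + i < N2 := by exact_mod_cast h2
  have h' : (i:ℝ) < a := by exact_mod_cast h
  obtain ⟨D, hDd⟩ : ∃ D : ℝ, D = (N1:ℝ) - a + 1 := ⟨_, rfl⟩
  rw [← hDd] at hB
  have hD : 0 < D := by linarith
  have hu' : p1 * (((r:ℝ)+1+i)*(D+i)) = p0 * (((N2:ℝ)-r-i)*(a-i)) := by
    rw [hDd]; linear_combination hu
  rw [div_mul_eq_mul_div, le_div_iff₀ (by linarith)]
  have hDi : 0 < D + i := by linarith
  refine le_of_mul_le_mul_right ?_ hDi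
  have key : ((N2:ℝ)-r-i)*(a-i) ≤ (M+H) * (D+i) := by
    calc ((N2:ℝ)-r-i)*(a-i) ≤ ((N2:ℝ)-r) * (g * D) := by
          apply mul_le_mul <;> linarith
      _ = (g * ((N2:ℝ)-r)) * D := by ring
      _ ≤ (M+H) * (D+i) := by
          apply mul_le_mul <;> linarith
  calc p1 * (M - H + L) * (D+i) ≤ p1 * ((r:ℝ)+1+i) * (D+i) := by
        gcongr
    _ = p0 * (((N2:ℝ)-r-i)*(a-i)) := by rw [← hu']; ring
    _ ≤ p0 * ((M+H) * (D+i)) := by gcongr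
    _ = _ := by ring

lemma tail_pow (p : ℕ → ℝ) (t : ℝ) (ht : 0 ≤ t) (s : ℕ)
    (h : ∀ k, s ≤ k → p (k+1) ≤ t * p k) (m k : ℕ) (hk : s ≤ k) : p (k+m) ≤ t^m * p k := by
  induction m with
  | zero => simp
  | succ m ih =>
    calc p (k+(m+1)) ≤ t * p (k+m) := h (k+m) (by omega)
      _ ≤ t * (t^m * p k) := by gcongr
      _ = _ := by ring

lemma assemble (p : ℕ → ℝ) (hp : ∀ k, 0 ≤ p k) (a r L : ℕ) (hz : ∀ k, a + r < k → p k = 0)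
    (Q τ : ℝ) (hQ : 0 ≤ Q) (hτ : 0 ≤ τ) (hLr : 2 * L ≤ r)
    (h1 : ∀ j, j < 2 * L → p (r+1+j) ≤ Q * p (r-j))
    (h2 : ∀ k, r + L ≤ k → p (k+L) ≤ τ * p k) :
    (1 - τ) * ∑ k ∈ Finset.range (a+r+1), p k ≤ (1+Q) * ∑ k ∈ Finset.range (r+1), p k := by
  have hT : ∀ b, ∑ k ∈ Finset.range b, p k ≤ ∑ k ∈ Finset.range (a+r+1), p k := by
    intro b
    rcases le_total b (a+r+1) with hb | hb
    · exact Finset.sum_le_sum_of_subset_of_nonneg (by simpa using hb) (fun _ _ _ => hp _)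
    · apply le_of_eq; symm
      apply Finset.sum_subset (by simpa using hb)
      intro x _ hx
      apply hz
      simp at hx; omega
  have hsplit : ∑ k ∈ Finset.range (a+r+1), p k ≤ ∑ k ∈ Finset.range (r+1), p k +
      ∑ j ∈ Finset.range (2*L), p (r+1+j) + ∑ j ∈ Finset.range a, p (r+1+2*L+j) := by
    rw [← Finset.sum_range_add, ← Finset.sum_range_add]
    exact Finset.sum_le_sum_of_subset_of_nonneg (by intro x; simp; omega) (fun _ _ _ => hp _)
  have hmid : ∑ j ∈ Finset.range (2*L), p (r+1+j) ≤ Q * ∑ k ∈ Finset.range (r+1), p k := by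
    calc _ ≤ ∑ j ∈ Finset.range (2*L), Q * p (r-j) :=
          Finset.sum_le_sum (fun j hj => h1 j (Finset.mem_range.1 hj))
      _ = Q * ∑ j ∈ Finset.range (2*L), p (r-j) := by rw [Finset.mul_sum]
      _ ≤ Q * ∑ j ∈ Finset.range (r+1), p (r-j) := by
          gcongr
          exact fun _ _ _ => hp _
          omega
      _ = _ := by
          congr 1
          rw [← Finset.sum_range_reflect (fun k => p k) (r+1)]
          apply Finset.sum_congr rfl
          intro j _
          congr 1
  have htail : ∑ j ∈ Finset.range a, p (r+1+2*L+j) ≤ τ * ∑ k ∈ Finset.range (a+r+1), p k := by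
    calc _ ≤ ∑ j ∈ Finset.range a, τ * p (r+1+L+j) := by
          apply Finset.sum_le_sum
          intro j _
          have := h2 (r+1+L+j) (by omega)
          rwa [show r+1+L+j+L = r+1+2*L+j by ring] at this
      _ = τ * ∑ j ∈ Finset.range a, p (r+1+L+j) := by rw [Finset.mul_sum]
      _ ≤ _ := by
          gcongr
          refine le_trans ?_ (hT (r+1+L+a))
          rw [Finset.sum_range_add]
          have := Finset.sum_nonneg (s := Finset.range (r+1+L)) (fun k _ => hp k)
          linarith
  linarith

lemma core (f : ℝ) (hf0 : 0 < f) (hf1 : f < 1/2) (N1 N2 a r w : ℕ) (ha : (a:ℝ) ≤ f * N1)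
    (hr1 : f * N2 - w ≤ r) (hr2 : (r:ℝ) ≤ f * N2) (hw1 : w^5 ≤ N2) (hw2 : N2 < (w+1)^5)
    (hfw : 8 ≤ f * (w:ℝ)^2) :
    (1 - Real.exp (-(w:ℝ)/64)) * ((N1+N2).choose (a+r) : ℝ) ≤
      (1 + Real.exp (32/(f^2*w))) * ∑ k ∈ Finset.range (r+1), hgP N1 N2 (a+r) k := by
  obtain ⟨x, hx⟩ : ∃ x : ℝ, x = w := ⟨_, rfl⟩
  obtain ⟨M, hM⟩ : ∃ M : ℝ, M = f * N2 := ⟨_, rfl⟩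
  have hw0 : w ≠ 0 := by rintro rfl; norm_num at hfw
  have hx1 : 1 ≤ x := by rw [hx]; exact_mod_cast Nat.one_le_iff_ne_zero.2 hw0
  have hx4 : 16 ≤ x^2 := by rw [hx]; nlinarith
  have hx44 : 4 ≤ x := by nlinarith
  have hN2 : x^5 ≤ N2 := by rw [hx]; exact_mod_cast hw1
  have hN2' : (N2:ℝ) ≤ 32 * x^5 := by
    have : (N2:ℝ) ≤ (x+1)^5 := by rw [hx]; exact_mod_cast hw2.le
    calc (N2:ℝ) ≤ (x+1)^5 := this
      _ ≤ (2*x)^5 := by gcongr; linarith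
      _ = _ := by ring
  rw [← hx] at hfw hr1 ⊢
  have hM1 : f * x^5 ≤ M := by rw [hM]; gcongr
  have hM3 : 8 * x^3 ≤ M := by
    calc 8 * x^3 ≤ (f * x^2) * x^3 := by gcongr
      _ = f * x^5 := by ring
      _ ≤ M := hM1
  have hx3 : 16 * x ≤ x^3 := by nlinarith
  have hM2 : M ≤ 16 * x^5 := by
    rw [hM]; nlinarith [pow_pos (by linarith : 0 < x) 5]
  have hMN : 2 * M ≤ N2 := by rw [hM]; nlinarith [(Nat.cast_nonneg N2 : (0:ℝ) ≤ N2)]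
  rw [← hM] at hr1 hr2
  have hN1 : (0:ℝ) ≤ N1 := by positivity
  have haN : a ≤ N1 := by
    have : (a:ℝ) ≤ N1 := by nlinarith
    exact_mod_cast this
  obtain ⟨g, hg⟩ : ∃ g : ℝ, g = f/(1-f) := ⟨_, rfl⟩
  have hf2 : 0 < 1 - f := by linarith
  have hgf : g * (1-f) = f := by rw [hg]; field_simp
  have hg0 : 0 ≤ g := by rw [hg]; positivity
  have hg1 : g ≤ 1 := by rw [hg, div_le_one hf2]; linarith
  have hB : (a:ℝ) ≤ g * ((N1:ℝ) - a + 1) := by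
    have : (1-f) * N1 ≤ (N1:ℝ) - a + 1 := by linarith
    calc (a:ℝ) ≤ f * N1 := ha
      _ = g * ((1-f) * N1) := by rw [← mul_assoc, hgf]
      _ ≤ _ := by gcongr
  have hA : g * ((N2:ℝ) - r) ≤ M + x := by
    calc g * ((N2:ℝ) - r) ≤ g * ((1-f) * N2 + x) := by
          apply mul_le_mul_of_nonneg_left _ hg0; linarith
      _ = (g * (1-f)) * N2 + g * x := by ring
      _ ≤ M + x := by rw [hgf, ← hM]; nlinarith
  have hC : M - x ≤ (r:ℝ) + 1 := by linarith
  have hMH : 0 < M - x := by nlinarith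
  obtain ⟨L, hL⟩ : ∃ L : ℕ, L = w^3 := ⟨_, rfl⟩
  have hLx : (L:ℝ) = x^3 := by rw [hL, hx]; push_cast; rfl
  have hLr : 2 * L ≤ r := by
    have : (2:ℝ) * L ≤ r := by rw [hLx]; linarith
    exact_mod_cast this
  have hJx : ((2*L : ℕ):ℝ) = 2 * x^3 := by push_cast; rw [hLx]
  have hM0 : 0 < M := by linarith
  obtain ⟨q, hq⟩ : ∃ q : ℝ, q = 1 + 16/(f^2*x^4) := ⟨_, rfl⟩
  have hq1 : 1 ≤ q := by rw [hq]; have : 0 ≤ 16/(f^2*x^4) := by positivity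
                         linarith
  have hQ : q^(2*L) ≤ Real.exp (32/(f^2*x)) := by
    calc q^(2*L) ≤ (Real.exp (16/(f^2*x^4)))^(2*L) := by
          gcongr
          rw [hq, add_comm]; exact Real.add_one_le_exp _
      _ = Real.exp (32/(f^2*x)) := by
          rw [← Real.exp_nat_mul, hJx]
          congr 1
          field_simp
          norm_num
  have hqq : (M+x)^2 ≤ q * ((M-x)^2 - ((2*L:ℕ):ℝ)^2) := by
    rw [hJx]
    exact q_alg f x M q hf0 hf1 hx44 hM1 hM3 hx3 hq
  rw [hgP_total]
  apply assemble _ (hgP_nonneg _ _ _) a r L (fun k hk => hgP_zero _ _ _ _ hk) _ _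
    (Real.exp_pos _).le (Real.exp_pos _).le hLr
  · intro j hj
    rcases le_or_gt (j+1) a with hja | hja
    · have := pair_bound N1 N2 a r (2*L) g M x q hg0 hg1 hB haN hA hC hMH (by linarith)
        (by rw [hJx]; linarith) (by rw [hJx]; linarith) hLr hqq j hj hja
      refine this.trans ?_
      apply mul_le_mul_of_nonneg_right _ (hgP_nonneg _ _ _ _)
      refine le_trans ?_ hQ
      exact pow_le_pow_right₀ hq1 (by omega)
    · rw [hgP_zero _ _ _ _ (by omega)]
      exact mul_nonneg (Real.exp_pos _).le (hgP_nonneg _ _ _ _)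
  · intro k hk
    have ht0 : 0 ≤ (M+x)/(M-x+L) := by apply div_nonneg <;> [linarith; (rw [hLx]; linarith)]
    have := tail_pow (hgP N1 N2 (a+r)) _ ht0 (r+L) (by
      intro k hk
      obtain ⟨i, rfl⟩ : ∃ i, k = r + i := ⟨k - r, by omega⟩
      exact tail_step N1 N2 a r L g M x hg0 hB haN hA hC hMH (by linarith) i (by omega)) L k hk
    refine this.trans ?_
    apply mul_le_mul_of_nonneg_right _ (hgP_nonneg _ _ _ _)
    have hle : (M+x)/(M-x+L) ≤ Real.exp (-1/(64*x^2)) := by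
      refine le_trans ?_ (Real.add_one_le_exp _)
      rw [hLx, div_le_iff₀ (by linarith)]
      have h5 : (M - x + x^3)/(64*x^2) ≤ x^3 - 2*x := by
        rw [div_le_iff₀ (by positivity)]
        nlinarith [pow_pos (by linarith : 0 < x) 3]
      have : (-1/(64*x^2) + 1) * (M - x + x^3) = (M-x+x^3) - (M - x + x^3)/(64*x^2) := by ring
      rw [this]; linarith
    calc ((M+x)/(M-x+L))^L ≤ (Real.exp (-1/(64*x^2)))^L := by gcongr
      _ = Real.exp (-x/64) := by
        rw [← Real.exp_nat_mul, hLx]; congr 1; field_simp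

theorem hypergeometric_half_below (f : ℝ) (hf0 : 0 < f) (hf1 : f < 1 / 2)
    (n₁ n₂ : ℕ → ℕ) (hsum : ∀ n, n₁ n + n₂ n = n)
    (h₁ : Tendsto n₁ atTop atTop) (h₂ : Tendsto n₂ atTop atTop) :
    ∃ h : ℕ → ℕ, Tendsto h atTop atTop ∧
    ∃ ε : ℕ → ℝ, Tendsto ε atTop (nhds 0) ∧
      ∀ n : ℕ, ∀ r : ℕ, f * n₂ n - h n ≤ (r : ℝ) → (r : ℝ) ≤ f * n₂ n →
        (1 / 2 - ε n) * (n.choose (⌊f * (n₁ n : ℝ)⌋₊ + r) : ℝ) ≤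
          ∑ k ∈ Finset.range (r + 1),
            ((n₂ n).choose k * (n₁ n).choose (⌊f * (n₁ n : ℝ)⌋₊ + r - k) : ℝ) := by
  have hex : ∀ N : ℕ, ∃ w : ℕ, w^5 ≤ N ∧ N < (w+1)^5 := by
    intro N
    refine ⟨Nat.findGreatest (fun w => w^5 ≤ N) N, ?_, ?_⟩
    · exact Nat.findGreatest_spec (P := fun w => w^5 ≤ N) (Nat.zero_le N) (by simp)
    · by_contra hc
      push Not at hc
      have h1 := Nat.le_findGreatest (P := fun w => w^5 ≤ N)
        (le_trans (Nat.le_self_pow (by norm_num) _) hc) hc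
      omega
  choose W hW1 hW2 using hex
  have hWt : Tendsto W atTop atTop := by
    rw [tendsto_atTop]
    intro b
    filter_upwards [eventually_ge_atTop (b^5)] with N hN
    by_contra hc
    push Not at hc
    have : (W N + 1)^5 ≤ b^5 := Nat.pow_le_pow_left hc 5
    have := hW2 N
    omega
  have hht : Tendsto (fun n => W (n₂ n)) atTop atTop := hWt.comp h₂
  have hxt : Tendsto (fun n => (W (n₂ n) : ℝ)) atTop atTop :=
    tendsto_natCast_atTop_atTop.comp hht
  refine ⟨fun n => W (n₂ n), hht, fun n => if 8 ≤ f * (W (n₂ n) : ℝ)^2 then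
    1/2 - (1 - Real.exp (-(W (n₂ n) : ℝ)/64)) / (1 + Real.exp (32/(f^2*(W (n₂ n) : ℝ)))) else 1/2,
    ?_, ?_⟩
  · have hev : ∀ᶠ n in atTop, 8 ≤ f * (W (n₂ n) : ℝ)^2 := by
      have : Tendsto (fun n => f * (W (n₂ n) : ℝ)^2) atTop atTop :=
        ((tendsto_pow_atTop (by norm_num)).comp hxt).const_mul_atTop hf0
      exact this.eventually_ge_atTop 8
    have hlim : Tendsto (fun n => 1/2 - (1 - Real.exp (-(W (n₂ n) : ℝ)/64)) /
        (1 + Real.exp (32/(f^2*(W (n₂ n) : ℝ))))) atTop (nhds (1/2 - (1 - 0)/(1+Real.exp 0))) := by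
      have t1 : Tendsto (fun n => Real.exp (-(W (n₂ n) : ℝ)/64)) atTop (nhds 0) := by
        apply Real.tendsto_exp_atBot.comp
        exact (tendsto_neg_atTop_atBot.comp hxt).atBot_div_const (by norm_num)
      have t2 : Tendsto (fun n => Real.exp (32/(f^2*(W (n₂ n) : ℝ)))) atTop (nhds (Real.exp 0)) := by
        apply (Real.continuous_exp.tendsto 0).comp
        exact (hxt.const_mul_atTop (by positivity : 0 < f^2)).const_div_atTop 32
      exact tendsto_const_nhds.sub ((tendsto_const_nhds.sub t1).div (tendsto_const_nhds.add t2)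
        (by positivity))
    have : (1/2 - (1 - 0)/(1+Real.exp 0) : ℝ) = 0 := by rw [Real.exp_zero]; norm_num
    rw [this] at hlim
    refine hlim.congr' ?_
    filter_upwards [hev] with n hn
    rw [if_pos hn]
  · intro n r hr1 hr2
    dsimp only
    split_ifs with hc
    · have hcore := core f hf0 hf1 (n₁ n) (n₂ n) ⌊f * (n₁ n : ℝ)⌋₊ r (W (n₂ n))
        (Nat.floor_le (by positivity)) hr1 hr2 (hW1 _) (hW2 _) hc
      rw [hsum n] at hcore
      have hS : ∑ k ∈ Finset.range (r+1), hgP (n₁ n) (n₂ n) (⌊f * (n₁ n : ℝ)⌋₊+r) k =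
          ∑ k ∈ Finset.range (r + 1),
            ((n₂ n).choose k * (n₁ n).choose (⌊f * (n₁ n : ℝ)⌋₊ + r - k) : ℝ) := by
        apply Finset.sum_congr rfl
        intro k hk
        have := Finset.mem_range.1 hk
        unfold hgP; rw [if_pos (by omega)]
      rw [hS] at hcore
      rw [sub_sub_cancel, div_mul_eq_mul_div, div_le_iff₀ (by positivity)]
      linarith
    · simp only [sub_self, zero_mul]
      positivity
end

section
/- Fix f ∈ (0,1/2) and for each integer n ≥ 3 set n₁ = n − ⌊(4/(1−2f)²)·log log n⌋ (natural logarithms), n₂ = n − n₁, F = ⌊fn⌋, and F₁ = ⌊f·n₁⌋. Then lim_{n→∞} (Σ_{k=F₁}^{F} Σ_{s=F₁}^{k} C(n₁,s)·C(n₂,k−s)) / (Σ_{k=0}^{F} C(n,k)) = 1/2. -/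
open Filter
open MeasureTheory ProbabilityTheory in

open MeasureTheory ProbabilityTheory Complex in
lemma bin_clt (f : unitInterval) (hf0 : 0 < (f:ℝ)) (hf1 : (f:ℝ) < 1) (x : ℝ) :
    Tendsto (fun m : ℕ => (binomial m f).real {j : ℕ | (√(m:ℝ))⁻¹ * (((j:ℝ) - m * f) / √(f * (1 - f))) ≤ x}) atTop
      (nhds ((gaussianReal 0 1).real (Set.Iic x))) := by
  set σ := √((f:ℝ) * (1 - f)) with hσ
  have hσ0 : 0 < (f:ℝ) * (1 - f) := mul_pos hf0 (by linarith)
  have hσ1 : 0 < σ := Real.sqrt_pos.2 hσ0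
  have hσ2 : σ ^ 2 = (f:ℝ) * (1 - f) := Real.sq_sqrt hσ0.le
  let T : ℕ → ℕ → ℝ := fun m j => (√(m:ℝ))⁻¹ * (((j:ℝ) - m * f) / σ)
  have hT : ∀ m, Measurable (T m) := fun m => measurable_of_countable _
  let μ : ℕ → ProbabilityMeasure ℝ := fun m =>
    ⟨(binomial m f).map (T m), Measure.isProbabilityMeasure_map (hT m).aemeasurable⟩
  have key : Tendsto μ atTop (nhds ⟨gaussianReal 0 1, inferInstance⟩) := by
    refine ProbabilityMeasure.tendsto_iff_tendsto_charFun.2 fun t ↦ ?_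
    have hm : Measurable (fun y : ℝ => (y - f) / σ) := by fun_prop
    have h := tendsto_charFun_inv_sqrt_mul_pow (P := bernoulliMeasure (1:ℝ) 0 f)
      (X := fun y => (y - f) / σ) hm.aemeasurable ?_ ?_ t
    · have e : ∀ m : ℕ, charFun ((μ m : ProbabilityMeasure ℝ) : Measure ℝ) t =
        (charFun ((bernoulliMeasure (1:ℝ) 0 f).map (fun y => (y - f) / σ)) ((√(m:ℝ))⁻¹ * t)) ^ m := by
        intro m
        have : charFun ((μ m : ProbabilityMeasure ℝ) : Measure ℝ) t
          = charFun ((binomial m f).map (T m)) t := rfl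
        rw [this, charFun_apply_real, charFun_apply_real, integral_map (hT m).aemeasurable (by fun_prop),
          integral_map hm.aemeasurable (by fun_prop), integral_binomial, integral_bernoulliMeasure]
        rw [add_pow, ← Nat.range_succ_eq_Iic]
        refine Finset.sum_congr rfl fun k hk => ?_
        have hk : k ≤ m := by simp at hk; omega
        simp only [Complex.real_smul, mul_pow, ← Complex.exp_nat_mul]
        have : cexp (t * (T m k : ℝ) * I) = cexp (k * (((√(m:ℝ))⁻¹ * t : ℝ) * (((1 - f) / σ : ℝ)) * I)) * cexp ((m - k : ℕ) * (((√(m:ℝ))⁻¹ * t : ℝ) * (((0 - f) / σ : ℝ)) * I)) := by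
          rw [← Complex.exp_add]
          congr 1
          simp only [T]
          push_cast [Nat.cast_sub hk]
          ring
        rw [this]
        push_cast
        ring
      simp only [e]
      have := charFun_gaussianReal (μ := 0) (v := 1) t
      convert h using 2
      simp only [ProbabilityMeasure.coe_mk]
      rw [this]; simp; ring_nf
    · rw [integral_bernoulliMeasure]
      simp; field_simp; ring
    · rw [integral_bernoulliMeasure]
      simp [div_pow]; rw [hσ2]; have : (1 - (f:ℝ)) ≠ 0 := by linarith
      field_simp; ring
  have := ProbabilityMeasure.tendsto_measure_of_null_frontier_of_tendsto' key (E := Set.Iic x) (by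
    simp
    have := nullSingletonClass_gaussianReal (μ := 0) (v := 1) (by simp)
    simp)
  have h2 := (ENNReal.tendsto_toReal (measure_ne_top (gaussianReal 0 1) (Set.Iic x))).comp this
  refine h2.congr fun m => ?_
  simp only [Function.comp, μ, ProbabilityMeasure.coe_mk]
  rw [Measure.map_apply (hT m) measurableSet_Iic]
  rfl

open MeasureTheory ProbabilityTheory in
lemma gauss_neg (x : ℝ) : (gaussianReal 0 1).real (Set.Iic (-x)) = 1 - (gaussianReal 0 1).real (Set.Iic x) := by
  have := nullSingletonClass_gaussianReal (μ := 0) (v := 1) (by simp)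
  have h : (gaussianReal 0 1).map (fun x => -x) = gaussianReal 0 1 := by
    rw [gaussianReal_map_neg]; simp
  conv_lhs => rw [← h]
  rw [map_measureReal_apply (by fun_prop) measurableSet_Iic]
  rw [← probReal_compl_eq_one_sub measurableSet_Iic]
  have : (fun x : ℝ => -x) ⁻¹' Set.Iic (-x) = Set.Ici x := by ext; simp
  rw [this, Set.compl_Iic]
  simp only [Measure.real]
  rw [measure_congr Ioi_ae_eq_Ici.symm]

open MeasureTheory ProbabilityTheory in
lemma gauss_near (ε : ℝ) (hε : 0 < ε) : ∃ δ > 0, (gaussianReal 0 1).real (Set.Iic δ) < 1/2 + ε := by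
  have h0 := gauss_neg 0
  rw [neg_zero] at h0
  have h := (cdf (gaussianReal 0 1)).right_continuous 0
  simp only [ContinuousWithinAt, cdf_eq_real] at h
  have h1 := (h.mono_left (nhdsWithin_mono _ Set.Ioi_subset_Ici_self)).eventually_lt_const (u := 1/2 + ε) (by linarith)
  obtain ⟨δ, hδ, h2⟩ := (h1.and self_mem_nhdsWithin).exists
  rw [cdf_eq_real] at hδ
  exact ⟨δ, h2, hδ⟩

open MeasureTheory ProbabilityTheory in
lemma bin_half (f : ℝ) (hf0 : 0 < f) (hf1 : f < 1) (ε C : ℝ) (hε : 0 < ε) :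
    ∃ M : ℕ, ∀ m ≥ M, ∀ D : ℕ, |(D:ℝ) - m * f| ≤ C →
      |∑ j ∈ Finset.range (D + 1), (m.choose j : ℝ) * f ^ j * (1 - f) ^ (m - j) - 1 / 2| ≤ ε := by
  let p : unitInterval := ⟨f, hf0.le, hf1.le⟩
  obtain ⟨δ, hδ, hg⟩ := gauss_near ε hε
  have hg' : 1 / 2 - ε < (gaussianReal 0 1).real (Set.Iic (-δ)) := by rw [gauss_neg]; linarith
  have h1 := (bin_clt p hf0 hf1 δ).eventually (gt_mem_nhds hg)
  have h2 := (bin_clt p hf0 hf1 (-δ)).eventually (lt_mem_nhds hg')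
  have hσ1 : 0 < √(f * (1 - f)) := Real.sqrt_pos.2 (mul_pos hf0 (by linarith))
  have h3 : Tendsto (fun m : ℕ => √(m:ℝ) * (√(f * (1 - f)) * δ)) atTop atTop :=
    (Real.tendsto_sqrt_atTop.comp tendsto_natCast_atTop_atTop).atTop_mul_const (by positivity)
  obtain ⟨M, hM⟩ := eventually_atTop.1 ((h1.and h2).and ((h3.eventually_ge_atTop C).and (eventually_ge_atTop 1)))
  refine ⟨M, fun m hm D hD => ?_⟩
  obtain ⟨⟨a1, a2⟩, a3, a4⟩ := hM m hm
  have hs : 0 < √(m:ℝ) := Real.sqrt_pos.2 (by exact_mod_cast a4)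
  have hD := abs_le.1 hD
  have iff1 : ∀ (j : ℕ) (x : ℝ), (√(m:ℝ))⁻¹ * (((j:ℝ) - m * f) / √(f * (1 - f))) ≤ x ↔ (j:ℝ) - m * f ≤ √(m:ℝ) * (√(f * (1 - f)) * x) := by
    intro j x
    rw [inv_mul_le_iff₀ hs, div_le_iff₀ hσ1]
    ring_nf
  have e : ∑ j ∈ Finset.range (D + 1), (m.choose j : ℝ) * f ^ j * (1 - f) ^ (m - j)
      = (binomial m p).real (Finset.range (D+1) : Set ℕ) := by
    rw [← sum_measureReal_singleton]
    exact Finset.sum_congr rfl fun j _ => (binomial_real_singleton m j p).symm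
  rw [e]
  have b1 : (binomial m p).real (Finset.range (D+1) : Set ℕ) ≤ (binomial m p).real {j : ℕ | (√(m:ℝ))⁻¹ * (((j:ℝ) - m * p) / √(p * (1 - p))) ≤ δ} := by
    refine measureReal_mono ?_
    intro j hj
    have : j ≤ D := by simp at hj; omega
    have : (j:ℝ) ≤ D := by exact_mod_cast this
    refine (iff1 j δ).2 ?_
    linarith
  have b2 : (binomial m p).real {j : ℕ | (√(m:ℝ))⁻¹ * (((j:ℝ) - m * p) / √(p * (1 - p))) ≤ -δ} ≤ (binomial m p).real (Finset.range (D+1) : Set ℕ) := by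
    refine measureReal_mono ?_
    intro j hj
    have := (iff1 j (-δ)).1 hj
    have : (j:ℝ) ≤ D := by linarith
    have : j ≤ D := by exact_mod_cast this
    simp; omega
  rw [abs_le]
  constructor <;> linarith

lemma choose_desc (n m k j : ℕ) (hj : j ≤ m) (hk : m ≤ k) (hn : k + m ≤ n) :
    (n - m).choose (k - j) * n.descFactorial m
      = n.choose k * (k.descFactorial j * (n - k).descFactorial (m - j)) := by
  have e1 := Nat.choose_mul_factorial_mul_factorial (show k - j ≤ n - m by omega)
  have e2 := Nat.choose_mul_factorial_mul_factorial (show k ≤ n by omega)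
  have e3 := Nat.factorial_mul_descFactorial (show m ≤ n by omega)
  have e4 := Nat.factorial_mul_descFactorial (show j ≤ k by omega)
  have e5 := Nat.factorial_mul_descFactorial (show m - j ≤ n - k by omega)
  have e6 : n - k - (m - j) = n - m - (k - j) := by omega
  rw [e6] at e5
  have p1 := Nat.factorial_pos (k - j)
  have p2 := Nat.factorial_pos (n - m - (k - j))
  refine Nat.eq_of_mul_eq_mul_right (Nat.mul_pos p1 p2) ?_
  calc _ = ((n - m).choose (k - j) * (k - j).factorial * (n - m - (k - j)).factorial) * n.descFactorial m := by ring
    _ = n.factorial := by rw [e1, e3]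
    _ = n.choose k * ((k - j).factorial * k.descFactorial j) * ((n - m - (k - j)).factorial * (n-k).descFactorial (m - j)) := by rw [e4, e5, e2]
    _ = _ := by ring

lemma hyp_lower (f δ : ℝ) (hf0 : 0 < f) (hf1 : f < 1) (hδ : 0 ≤ δ) (hδ1 : δ ≤ 1) (n m k j : ℕ) (hn0 : 0 < n)
    (hk : m ≤ k) (hn : k + m ≤ n)
    (h1 : n * (f * (1 - δ)) ≤ (k:ℝ) - m) (h2 : n * ((1 - f) * (1 - δ)) ≤ (n:ℝ) - k - m) :
    (1 - m * δ) * ((m.choose j : ℝ) * f ^ j * (1 - f) ^ (m - j)) ≤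
      (m.choose j : ℝ) * (n - m).choose (k - j) / n.choose k := by
  rcases lt_or_ge m j with hj | hj
  · simp [Nat.choose_eq_zero_of_lt hj]
  have hc : (0:ℝ) < n.choose k := by exact_mod_cast Nat.choose_pos (by omega)
  have hn' : (0:ℝ) < n := by exact_mod_cast hn0
  have hd : (0:ℝ) < n.descFactorial m := by exact_mod_cast Nat.descFactorial_pos.2 (by omega)
  have e : ((n - m).choose (k - j) : ℝ) / n.choose k = (k.descFactorial j * (n - k).descFactorial (m - j)) / n.descFactorial m := by
    rw [div_eq_div_iff hc.ne' hd.ne']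
    have := choose_desc n m k j hj hk hn
    rw [mul_comm (_ * _ : ℝ)]
    exact_mod_cast this
  have d1 : (n * (f * (1 - δ))) ^ j ≤ (k.descFactorial j : ℝ) := by
    calc _ ≤ ((k + 1 - j : ℕ) : ℝ) ^ j := by
          refine pow_le_pow_left₀ (by have := sub_nonneg.2 hδ1; positivity) ?_ _
          refine h1.trans ?_
          have : k ≤ (k + 1 - j) + m := by omega
          have : (k:ℝ) ≤ (k + 1 - j : ℕ) + m := by exact_mod_cast this
          linarith
      _ ≤ _ := by exact_mod_cast Nat.pow_sub_le_descFactorial k j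
  have d2 : (n * ((1 - f) * (1 - δ))) ^ (m - j) ≤ ((n - k).descFactorial (m - j) : ℝ) := by
    calc _ ≤ ((n - k + 1 - (m - j) : ℕ) : ℝ) ^ (m - j) := by
          refine pow_le_pow_left₀ (by have := sub_nonneg.2 hδ1; have := sub_nonneg.2 hf1.le; positivity) ?_ _
          refine h2.trans ?_
          have : n ≤ (n - k + 1 - (m - j)) + m + k := by omega
          have : (n:ℝ) ≤ (n - k + 1 - (m - j) : ℕ) + m + k := by exact_mod_cast this
          linarith
      _ ≤ _ := by exact_mod_cast Nat.pow_sub_le_descFactorial (n - k) (m - j)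
  have d3 : (n.descFactorial m : ℝ) ≤ n ^ m := by exact_mod_cast Nat.descFactorial_le_pow n m
  have hb : 1 - m * δ ≤ (1 - δ) ^ m := by
    have := one_add_mul_le_pow (show (-2:ℝ) ≤ -δ by linarith) m
    calc _ = 1 + m * (-δ) := by ring
      _ ≤ _ := this
      _ = _ := by ring
  have f1 : 0 ≤ 1 - f := by linarith
  have g1 : 0 ≤ 1 - δ := by linarith
  have main : (1 - m * δ) * (f ^ j * (1 - f) ^ (m - j)) ≤ ((n - m).choose (k - j) : ℝ) / n.choose k := by
    rw [e, le_div_iff₀ hd]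
    calc _ ≤ (1 - δ) ^ m * (f ^ j * (1 - f) ^ (m - j)) * n ^ m := by gcongr
      _ = (n * (f * (1 - δ))) ^ j * (n * ((1 - f) * (1 - δ))) ^ (m - j) := by
          obtain ⟨i, rfl⟩ := Nat.exists_eq_add_of_le hj
          simp only [Nat.add_sub_cancel_left, mul_pow, pow_add]
          ring
      _ ≤ _ := by gcongr
  calc _ = (m.choose j : ℝ) * ((1 - m * δ) * (f ^ j * (1 - f) ^ (m - j))) := by ring
    _ ≤ (m.choose j : ℝ) * (((n - m).choose (k - j) : ℝ) / n.choose k) := by gcongr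
    _ = _ := by ring

lemma vander (n m k : ℕ) (hk : m ≤ k) (hn : k + m ≤ n) :
    ∑ j ∈ Finset.range (m + 1), ((m.choose j : ℝ) * (n - m).choose (k - j)) = n.choose k := by
  have h := Nat.add_choose_eq m (n - m) k
  rw [Nat.add_sub_cancel' (by omega), Finset.Nat.sum_antidiagonal_eq_sum_range_succ (fun a b => m.choose a * (n-m).choose b)] at h
  rw [h]
  push_cast
  refine Finset.sum_subset (by intro; simp; omega) ?_
  intro x _ hx
  simp at hx
  simp [Nat.choose_eq_zero_of_lt (show m < x by omega)]

lemma hyp_close (f δ : ℝ) (hf0 : 0 < f) (hf1 : f < 1) (hδ : 0 ≤ δ) (hδ1 : δ ≤ 1) (n m k D : ℕ) (hn0 : 0 < n)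
    (hk : m ≤ k) (hn : k + m ≤ n) (hD : D ≤ m)
    (h1 : n * (f * (1 - δ)) ≤ (k:ℝ) - m) (h2 : n * ((1 - f) * (1 - δ)) ≤ (n:ℝ) - k - m) :
    |∑ j ∈ Finset.range (D + 1), (m.choose j : ℝ) * (n - m).choose (k - j) / n.choose k
      - ∑ j ∈ Finset.range (D + 1), (m.choose j : ℝ) * f ^ j * (1 - f) ^ (m - j)| ≤ m * δ := by
  set h : ℕ → ℝ := fun j => (m.choose j : ℝ) * (n - m).choose (k - j) / n.choose k
  set b : ℕ → ℝ := fun j => (m.choose j : ℝ) * f ^ j * (1 - f) ^ (m - j)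
  have hl : ∀ j, (1 - m * δ) * b j ≤ h j := fun j =>
    hyp_lower f δ hf0 hf1 hδ hδ1 n m k j hn0 hk hn h1 h2
  have hc : (0:ℝ) < n.choose k := by exact_mod_cast Nat.choose_pos (by omega)
  have sh : ∑ j ∈ Finset.range (m + 1), h j = 1 := by
    simp only [h]
    rw [← Finset.sum_div, vander n m k hk hn, div_self hc.ne']
  have sb : ∑ j ∈ Finset.range (m + 1), b j = 1 := by
    have := add_pow f (1 - f) m
    simp at this
    rw [this]
    exact Finset.sum_congr rfl fun j _ => by simp only [b]; ring
  have hb0 : ∀ j, 0 ≤ b j := fun j => by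
    have f1 : 0 ≤ 1 - f := by linarith
    simp only [b]; positivity
  have hle : D + 1 ≤ m + 1 := by omega
  rw [← Finset.sum_range_add_sum_Ico _ hle] at sh sb
  have l1 : (1 - m * δ) * ∑ j ∈ Finset.range (D + 1), b j ≤ ∑ j ∈ Finset.range (D + 1), h j := by
    rw [Finset.mul_sum]; exact Finset.sum_le_sum fun j _ => hl j
  have l2 : (1 - m * δ) * ∑ j ∈ Finset.Ico (D + 1) (m + 1), b j ≤ ∑ j ∈ Finset.Ico (D + 1) (m + 1), h j := by
    rw [Finset.mul_sum]; exact Finset.sum_le_sum fun j _ => hl j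
  have z1 : 0 ≤ ∑ j ∈ Finset.range (D + 1), b j := Finset.sum_nonneg fun j _ => hb0 j
  have z2 : 0 ≤ ∑ j ∈ Finset.Ico (D + 1) (m + 1), b j := Finset.sum_nonneg fun j _ => hb0 j
  have z3 : 0 ≤ m * δ := by positivity
  set x := ∑ j ∈ Finset.range (D + 1), b j
  set y := ∑ j ∈ Finset.Ico (D + 1) (m + 1), b j
  have p1 : m * δ * x ≤ m * δ := by nlinarith
  have p2 : m * δ * y ≤ m * δ := by nlinarith
  rw [abs_le]
  constructor <;> linarith

/-- inner sum -/
noncomputable def innerSum (n m F₁ k : ℕ) : ℝ :=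
  ∑ s ∈ Finset.Icc F₁ k, ((n - m).choose s * m.choose (k - s) : ℝ)

lemma innerSum_nonneg (n m F₁ k : ℕ) : 0 ≤ innerSum n m F₁ k := by
  unfold innerSum; positivity

lemma innerSum_le (n m F₁ k : ℕ) (hm : m ≤ n) : innerSum n m F₁ k ≤ n.choose k := by
  have h := Nat.add_choose_eq (n - m) m k
  rw [Nat.sub_add_cancel hm, Finset.Nat.sum_antidiagonal_eq_sum_range_succ (fun a b => (n-m).choose a * m.choose b)] at h
  rw [h]
  push_cast
  refine Finset.sum_le_sum_of_subset_of_nonneg (by intro x; simp) ?_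
  intros; positivity

lemma innerSum_eq (n m F₁ k : ℕ) (hk : F₁ ≤ k) : innerSum n m F₁ k =
    ∑ j ∈ Finset.range (k - F₁ + 1), (m.choose j : ℝ) * (n - m).choose (k - j) := by
  unfold innerSum
  refine Finset.sum_nbij' (fun s => k - s) (fun j => k - j) ?_ ?_ ?_ ?_ ?_
  · intro s; simp; omega
  · intro s; simp; omega
  · intro s; simp; omega
  · intro s; simp; omega
  · intro s hs
    simp at hs
    rw [Nat.sub_sub_self hs.2, mul_comm]

lemma choose_ratio (f : ℝ) (hf0 : 0 < f) (hf1 : f < 1 / 2) (n F : ℕ) (hF : (F:ℝ) ≤ f * n) (g : ℕ) (hg : g ≤ F) :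
    (n.choose (F - g) : ℝ) ≤ (f / (1 - f)) ^ g * n.choose F := by
  have f1 : 0 < 1 - f := by linarith
  induction g with
  | zero => simp
  | succ g ih =>
    have ih := ih (by omega)
    obtain ⟨k, hk⟩ : ∃ k, F - g = k + 1 := ⟨F - g - 1, by omega⟩
    have hk' : F - (g + 1) = k := by omega
    rw [hk] at ih
    rw [hk', pow_succ']
    have hn0 : (0:ℝ) ≤ n := by positivity
    have hkF : (k:ℝ) + 1 ≤ F := by exact_mod_cast (show k + 1 ≤ F by omega)
    have hkn : k ≤ n := by
      have : (k:ℝ) ≤ n := by nlinarith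
      exact_mod_cast this
    have e := Nat.choose_succ_right_eq n k
    have e : (n.choose (k+1) : ℝ) * (k + 1) = n.choose k * (n - k) := by
      rw [← Nat.cast_sub hkn]; exact_mod_cast e
    have c0 : (0:ℝ) ≤ n.choose k := by positivity
    have c1 : (0:ℝ) ≤ n.choose (k+1) := by positivity
    have n0 : (0:ℝ) < n := by nlinarith [(by positivity : (0:ℝ) ≤ k)]
    have : (n.choose k : ℝ) ≤ f / (1 - f) * n.choose (k + 1) := by
      rw [div_mul_eq_mul_div, le_div_iff₀ f1]
      refine le_of_mul_le_mul_right ?_ n0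
      have a1 : (n.choose k : ℝ) * ((1 - f) * n) ≤ n.choose k * (n - k) := by
        gcongr; nlinarith
      have a2 : (n.choose (k+1) : ℝ) * (k + 1) ≤ n.choose (k+1) * (f * n) := by
        gcongr; linarith
      nlinarith
    calc _ ≤ _ := this
      _ ≤ f / (1 - f) * ((f / (1 - f)) ^ g * n.choose F) := by gcongr
      _ = _ := by ring

lemma inner_tendsto (f : ℝ) (hf0 : 0 < f) (hf1 : f < 1 / 2) (m : ℕ → ℕ) (hm : ∀ n, m n ≤ n)
    (hmt : Tendsto m atTop atTop) (hm2 : Tendsto (fun n : ℕ => (m n : ℝ) ^ 2 / n) atTop (nhds 0)) (g : ℕ) :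
    Tendsto (fun n : ℕ => innerSum n (m n) ⌊f * ((n - m n : ℕ) : ℝ)⌋₊ (⌊f * n⌋₊ - g) / n.choose (⌊f * n⌋₊ - g))
      atTop (nhds (1 / 2)) := by
  rw [Metric.tendsto_atTop']
  intro ε hε
  obtain ⟨M, hM⟩ := bin_half f hf0 (by linarith) (ε / 4) (g + 1) (by linarith)
  have hm3 : Tendsto (fun n : ℕ => ((g:ℝ) + 2) / f * ((m n : ℝ) ^ 2 / n)) atTop (nhds 0) := by
    simpa using hm2.const_mul (((g:ℝ) + 2) / f)
  have hmr : Tendsto (fun n => (m n : ℝ)) atTop atTop := tendsto_natCast_atTop_atTop.comp hmt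
  have ev := ((hm3.eventually_lt_const (u := min 1 (ε / 4)) (by positivity)).and (hmt.eventually_ge_atTop (M + 2))).and
    ((hmr.eventually_ge_atTop ((g + 1) / f)).and (eventually_gt_atTop 0))
  obtain ⟨N, hN⟩ := eventually_atTop.1 ev
  refine ⟨N, fun n hn => ?_⟩
  obtain ⟨⟨h1, h2⟩, h3, h4⟩ := hN n hn.le
  have hmn := hm n
  generalize m n = m at *
  have hnr : (0:ℝ) < n := by exact_mod_cast h4
  have hm2r : (2:ℝ) ≤ m := by exact_mod_cast (show 2 ≤ m by omega)
  have hgr : (0:ℝ) ≤ g := by positivity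
  set δ : ℝ := (g + 1 + m) / (f * n) with hδ
  have hfn : 0 < f * n := by positivity
  have δ0 : 0 ≤ δ := by positivity
  have hmδ : m * δ ≤ ((g:ℝ) + 2) / f * ((m : ℝ) ^ 2 / n) := by
    rw [hδ, div_mul_div_comm, mul_div_assoc']
    refine div_le_div_of_nonneg_right ?_ hfn.le
    nlinarith [mul_nonneg hgr (show (0:ℝ) ≤ m - 1 by linarith)]
  have hmδ' := hmδ.trans_lt h1
  have hmδ1 : m * δ < 1 := hmδ'.trans_le (min_le_left _ _)
  have hmδ2 : m * δ < ε / 4 := hmδ'.trans_le (min_le_right _ _)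
  have δ1 : δ ≤ 1 := by nlinarith [mul_nonneg (show (0:ℝ) ≤ m - 1 by linarith) δ0]
  have hδe : δ * (f * n) = g + 1 + m := by rw [hδ]; field_simp
  have hbig : (g:ℝ) + 1 + m ≤ f * n := by
    rw [← hδe]; exact mul_le_of_le_one_left hfn.le δ1
  rw [div_le_iff₀ hf0] at h3
  have hfn2 : f * n ≤ n / 2 := by nlinarith
  have hfm2 : f * m ≤ m := by nlinarith
  -- floors
  set F := ⌊f * n⌋₊ with hF
  set F₁ := ⌊f * ((n - m : ℕ) : ℝ)⌋₊ with hF₁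
  have A1 : (F:ℝ) ≤ f * n := Nat.floor_le hfn.le
  have A2 : f * n < F + 1 := Nat.lt_floor_add_one _
  have B1 : (F₁:ℝ) ≤ f * ((n - m : ℕ) : ℝ) := Nat.floor_le (by positivity)
  have B2 : f * ((n - m : ℕ) : ℝ) < F₁ + 1 := Nat.lt_floor_add_one _
  rw [Nat.cast_sub hmn] at B1 B2
  have hgF : F₁ + g ≤ F := by
    have : (F₁ + g : ℝ) < F + 1 := by linarith
    have : F₁ + g < F + 1 := by exact_mod_cast this
    omega
  obtain ⟨k, hk⟩ : ∃ k, F = k + g := ⟨F - g, by omega⟩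
  have hk' : F - g = k := by omega
  have hkF₁ : F₁ ≤ k := by omega
  have hkr : (F:ℝ) = k + g := by exact_mod_cast hk
  rw [hk', innerSum_eq _ _ _ _ hkF₁, Finset.sum_div]
  have hmk : m ≤ k := by
    have : (m:ℝ) < k + 1 := by linarith
    have : m < k + 1 := by exact_mod_cast this
    omega
  have hkmn : k + m ≤ n := by
    have : (k:ℝ) + m ≤ n := by linarith
    exact_mod_cast this
  have hDr : ((k - F₁ : ℕ) : ℝ) = k - F₁ := by rw [Nat.cast_sub hkF₁]
  have hDm : k - F₁ ≤ m := by
    have : ((k - F₁ : ℕ) : ℝ) < m + 1 := by rw [hDr]; linarith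
    have : k - F₁ < m + 1 := by exact_mod_cast this
    omega
  have c1 := hyp_close f δ hf0 (by linarith) δ0 δ1 n m k (k - F₁) h4 hmk hkmn hDm
    (by linarith) (by
      have : δ * (f * n) ≤ δ * ((1 - f) * n) := by gcongr; linarith
      linarith)
  have c2 := hM m (by omega) (k - F₁) (by
    rw [hDr, abs_le]; constructor <;> linarith)
  rw [Real.dist_eq]
  have := abs_le.1 c1
  have := abs_le.1 c2
  rw [abs_lt]
  constructor <;> linarith

lemma main_tendsto (f : ℝ) (hf0 : 0 < f) (hf1 : f < 1 / 2) (m : ℕ → ℕ) (hm : ∀ n, m n ≤ n)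
    (hmt : Tendsto m atTop atTop) (hm2 : Tendsto (fun n : ℕ => (m n : ℝ) ^ 2 / n) atTop (nhds 0)) :
    Tendsto (fun n : ℕ => (∑ k ∈ Finset.Icc ⌊f * ((n - m n : ℕ) : ℝ)⌋₊ ⌊f * n⌋₊,
        innerSum n (m n) ⌊f * ((n - m n : ℕ) : ℝ)⌋₊ k) /
        ∑ k ∈ Finset.range (⌊f * n⌋₊ + 1), (n.choose k : ℝ)) atTop (nhds (1 / 2)) := by
  let F : ℕ → ℕ := fun n => ⌊f * n⌋₊
  let F₁ : ℕ → ℕ := fun n => ⌊f * ((n - m n : ℕ) : ℝ)⌋₊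
  let S : ℕ → ℝ := fun n => ∑ k ∈ Finset.range (F n + 1), (n.choose k : ℝ)
  let G : ℕ → ℕ → ℝ := fun n g => if g ≤ F n then
    (innerSum n (m n) (F₁ n) (F n - g) - n.choose (F n - g) / 2) / S n else 0
  have hFn : ∀ n, (F n : ℝ) ≤ f * n := fun n => Nat.floor_le (by positivity)
  have hFn' : ∀ n, F n ≤ n := fun n => by
    have : (F n : ℝ) ≤ n := (hFn n).trans (by nlinarith [(by positivity : (0:ℝ) ≤ n)])
    exact_mod_cast this
  have hcS : ∀ n k, k ≤ F n → (n.choose k : ℝ) ≤ S n := fun n k hk =>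
    Finset.single_le_sum (f := fun k => (n.choose k : ℝ)) (fun _ _ => by positivity) (by simp; omega)
  have hc0 : ∀ n k, k ≤ F n → (0:ℝ) < n.choose k := fun n k hk => by
    exact_mod_cast Nat.choose_pos (hk.trans (hFn' n))
  have hS0 : ∀ n, 0 < S n := fun n => (hc0 n 0 (by omega)).trans_le (hcS n 0 (by omega))
  have f1 : 0 < 1 - f := by linarith
  have hq0 : 0 ≤ f / (1 - f) := by positivity
  have hq1 : f / (1 - f) < 1 := by rw [div_lt_one f1]; linarith
  have hN : ∀ n g, |innerSum n (m n) (F₁ n) (F n - g) - n.choose (F n - g) / 2| ≤ n.choose (F n - g) := by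
    intro n g
    have a := innerSum_nonneg n (m n) (F₁ n) (F n - g)
    have b := innerSum_le n (m n) (F₁ n) (F n - g) (hm n)
    rw [abs_le]; constructor <;> linarith
  have T : Tendsto (fun n => ∑' g, G n g) atTop (nhds (∑' _ : ℕ, (0:ℝ))) := by
    refine tendsto_tsum_of_dominated_convergence (bound := fun g => (f / (1 - f)) ^ g)
      (summable_geometric_of_lt_one hq0 hq1) ?_ ?_
    · intro g
      have h := inner_tendsto f hf0 hf1 m hm hmt hm2 g
      have h' := (h.sub_const (1/2)).abs
      simp only [sub_self, abs_zero] at h'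
      refine squeeze_zero_norm (fun n => ?_) h'
      simp only [G]
      split_ifs with hg
      · have c := hc0 n (F n - g) (by omega)
        have : innerSum n (m n) (F₁ n) (F n - g) - n.choose (F n - g) / 2 =
          n.choose (F n - g) * (innerSum n (m n) (F₁ n) (F n - g) / n.choose (F n - g) - 1 / 2) := by
          field_simp
        rw [this, norm_div, norm_mul, Real.norm_of_nonneg c.le, Real.norm_of_nonneg (hS0 n).le,
          div_le_iff₀ (hS0 n), mul_comm, Real.norm_eq_abs]
        exact mul_le_mul_of_nonneg_left (hcS n _ (by omega)) (abs_nonneg _)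
      · simp
    · refine Eventually.of_forall fun n g => ?_
      simp only [G]
      split_ifs with hg
      · rw [norm_div, Real.norm_of_nonneg (hS0 n).le, div_le_iff₀ (hS0 n), Real.norm_eq_abs]
        refine (hN n g).trans ((choose_ratio f hf0 hf1 n (F n) (hFn n) g hg).trans ?_)
        exact mul_le_mul_of_nonneg_left (hcS n _ le_rfl) (by positivity)
      · simp; positivity
  rw [tsum_zero] at T
  have T2 := T.add_const (1 / 2)
  rw [zero_add] at T2
  refine T2.congr fun n => ?_
  have e1 : ∑' g, G n g = ∑ g ∈ Finset.range (F n + 1), G n g := by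
    refine tsum_eq_sum fun g hg => ?_
    simp at hg
    simp only [G]
    rw [if_neg (by omega)]
  have e2 : ∑ g ∈ Finset.range (F n + 1), G n g = ∑ g ∈ Finset.range (F n + 1),
      (innerSum n (m n) (F₁ n) (F n + 1 - 1 - g) - n.choose (F n + 1 - 1 - g) / 2) / S n := by
    refine Finset.sum_congr rfl fun g hg => ?_
    simp at hg
    simp only [G]
    rw [if_pos (by omega), Nat.add_sub_cancel]
  have e3 : ∑ k ∈ Finset.Icc (F₁ n) (F n), innerSum n (m n) (F₁ n) k
      = ∑ k ∈ Finset.range (F n + 1), innerSum n (m n) (F₁ n) k := by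
    refine Finset.sum_subset (by intro; simp) ?_
    intro k hk hk'
    simp at hk hk'
    unfold innerSum
    rw [Finset.Icc_eq_empty (by omega)]
    simp
  rw [e1, e2, Finset.sum_range_reflect (fun k => (innerSum n (m n) (F₁ n) k - n.choose k / 2) / S n),
    ← Finset.sum_div, Finset.sum_sub_distrib, ← Finset.sum_div]
  change (_ - S n / 2) / S n + 1 / 2 = (∑ k ∈ Finset.Icc (F₁ n) (F n), innerSum n (m n) (F₁ n) k) / S n
  rw [e3]
  have := (hS0 n).ne'
  field_simp
  ring


theorem hypergeometric_sum_half (f : ℝ) (hf0 : 0 < f) (hf1 : f < 1 / 2) :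
    Tendsto (fun n : ℕ =>
      let n₁ := n - ⌊(4 / (1 - 2 * f) ^ 2) * Real.log (Real.log n)⌋₊
      let n₂ := n - n₁
      let F := ⌊f * n⌋₊
      let F₁ := ⌊f * (n₁ : ℝ)⌋₊
      (∑ k ∈ Finset.Icc F₁ F, ∑ s ∈ Finset.Icc F₁ k,
          (n₁.choose s * n₂.choose (k - s) : ℝ)) /
        ∑ k ∈ Finset.range (F + 1), (n.choose k : ℝ))
      atTop (nhds (1 / 2)) := by
  have hc : 0 < 4 / (1 - 2 * f) ^ 2 := by
    have : 0 < 1 - 2 * f := by linarith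
    positivity
  set c := 4 / (1 - 2 * f) ^ 2
  let x : ℕ → ℕ := fun n => ⌊c * Real.log (Real.log n)⌋₊
  let m : ℕ → ℕ := fun n => n - (n - x n)
  have hm : ∀ n, m n ≤ n := fun n => Nat.sub_le _ _
  have hnm : ∀ n, n - m n = n - x n := fun n => by simp only [m]; omega
  have hmx : ∀ n, m n ≤ x n := fun n => by simp only [m]; omega
  have hlog : Tendsto (fun n : ℕ => Real.log n) atTop atTop :=
    Real.tendsto_log_atTop.comp tendsto_natCast_atTop_atTop
  have hx : Tendsto x atTop atTop :=
    tendsto_nat_floor_atTop.comp ((Real.tendsto_log_atTop.comp hlog).const_mul_atTop hc)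
  have hmt : Tendsto m atTop atTop := by
    rw [tendsto_atTop]
    intro b
    filter_upwards [hx.eventually_ge_atTop b, eventually_ge_atTop b] with n h1 h2
    simp only [m]; omega
  have hm2 : Tendsto (fun n : ℕ => (m n : ℝ) ^ 2 / n) atTop (nhds 0) := by
    have h0 : Tendsto (fun n : ℕ => c ^ 2 * (Real.log n ^ 2 / (n:ℝ))) atTop (nhds 0) := by
      have := ((Real.isLittleO_pow_log_id_atTop (n := 2)).tendsto_div_nhds_zero.comp
        (tendsto_natCast_atTop_atTop (R := ℝ))).const_mul (c ^ 2)
      simpa using this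
    refine squeeze_zero' (Eventually.of_forall fun n => by positivity) ?_ h0
    filter_upwards [hlog.eventually_ge_atTop 1] with n hn
    have a0 : 0 ≤ Real.log (Real.log n) := Real.log_nonneg hn
    have a1 : (x n : ℝ) ≤ c * Real.log (Real.log n) := Nat.floor_le (by positivity)
    have a2 : Real.log (Real.log n) ≤ Real.log n := Real.log_le_self (by linarith)
    have a3 : (m n : ℝ) ≤ x n := by exact_mod_cast hmx n
    have a4 : (m n : ℝ) ≤ c * Real.log n := a3.trans (a1.trans (by gcongr))
    rw [mul_div_assoc', ← mul_pow]
    gcongr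
  refine (main_tendsto f hf0 hf1 m hm hmt hm2).congr fun n => ?_
  simp only [innerSum, hnm]
  rfl
end

section
/- Let u and v be position vectors of length M. Then: (1) EVEN(u) ≤ ODD(u); (2) if u ≤ v then EVEN(u) ≤ EVEN(v); and (3) if u ≤ v then ODD(u) ≤ ODD(v). -/
/-- The (weak majorization) partial order on position vectors:
`u ≤ v` iff every prefix sum of `u` is at most the corresponding prefix sum of `v`. -/
def PosLE {M : ℕ} (u v : Fin M → ℕ) : Prop :=
  ∀ k : Fin M, ∑ j ∈ Finset.Iic k, u j ≤ ∑ j ∈ Finset.Iic k, v j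

/-- The nondecreasing rearrangement of a vector. -/
def sortVec {M : ℕ} (u : Fin M → ℕ) : Fin M → ℕ := u ∘ Tuple.sort u

/-- `ODD(u)`: add one to every odd-indexed entry (1-based: indices 1,3,5,…; these are the
entries with even 0-based index) and rearrange in nondecreasing order. -/
def oddMove {M : ℕ} (u : Fin M → ℕ) : Fin M → ℕ :=
  sortVec (fun i => u i + if (i : ℕ) % 2 = 0 then 1 else 0)

/-- `EVEN(u)`: add one to every even-indexed entry (1-based: indices 2,4,6,…; these are the
entries with odd 0-based index) and rearrange in nondecreasing order. -/
def evenMove {M : ℕ} (u : Fin M → ℕ) : Fin M → ℕ :=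
  sortVec (fun i => u i + if (i : ℕ) % 2 = 1 then 1 else 0)

/-- Total truncated deficit below level `t`. -/
def defSum {M : ℕ} (w : Fin M → ℕ) (t : ℕ) : ℕ := ∑ i, (t - w i)

theorem defSum_sortVec {M : ℕ} (w : Fin M → ℕ) (t : ℕ) :
    defSum (sortVec w) t = defSum w t := by
  unfold defSum sortVec
  exact Equiv.sum_comp (Tuple.sort w) (fun i => t - w i)

theorem defSum_ge {M : ℕ} (w : Fin M → ℕ) (t : ℕ) (k : Fin M) :
    ∑ _j ∈ Finset.Iic k, t ≤ defSum w t + ∑ j ∈ Finset.Iic k, w j := by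
  have h1 : ∑ j ∈ Finset.Iic k, (t - w j) ≤ defSum w t :=
    Finset.sum_le_sum_of_subset (Finset.subset_univ _)
  have h2 : ∑ _j ∈ Finset.Iic k, t ≤ ∑ j ∈ Finset.Iic k, ((t - w j) + w j) :=
    Finset.sum_le_sum (fun i _ => by omega)
  rw [Finset.sum_add_distrib] at h2
  omega

theorem defSum_eq {M : ℕ} (w : Fin M → ℕ) (t : ℕ) (k : Fin M)
    (h1 : ∀ j ≤ k, w j ≤ t) (h2 : ∀ j, k < j → t ≤ w j) :
    ∑ _j ∈ Finset.Iic k, t = defSum w t + ∑ j ∈ Finset.Iic k, w j := by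
  have e : ∑ j ∈ Finset.Iic k, (t - w j) = defSum w t := by
    refine Finset.sum_subset (Finset.subset_univ _) ?_
    intro j _ hj
    rw [Finset.mem_Iic, not_le] at hj
    have := h2 j hj
    omega
  rw [← e, ← Finset.sum_add_distrib]
  refine Finset.sum_congr rfl ?_
  intro j hj
  have := h1 j (Finset.mem_Iic.1 hj)
  omega

theorem posLE_of_defSum {M : ℕ} (w w' : Fin M → ℕ) (hw : Monotone w)
    (h : ∀ t, defSum w' t ≤ defSum w t) : PosLE w w' := by
  intro k
  have a := defSum_eq w (w k) k (fun j hj => hw hj) (fun j hj => hw hj.le)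
  have b := defSum_ge w' (w k) k
  have c := h (w k)
  omega

theorem defSum_of_posLE {M : ℕ} (w w' : Fin M → ℕ) (hw : Monotone w')
    (h : PosLE w w') (t : ℕ) : defSum w' t ≤ defSum w t := by
  by_cases hne : (Finset.univ.filter (fun j => w' j < t)).Nonempty
  · obtain ⟨k, hk, hmax⟩ := Finset.exists_max_image _ id hne
    have hk' : w' k < t := by simpa using hk
    have a := defSum_eq w' t k (fun j hj => (hw hj).trans hk'.le) (fun j hj => by
      by_contra hlt
      have := hmax j (by simpa using hlt)
      exact absurd this (not_le.2 hj))
    have b := defSum_ge w t k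
    have c := h k
    omega
  · have : defSum w' t = 0 := by
      unfold defSum
      refine Finset.sum_eq_zero ?_
      intro i _
      by_contra hi
      exact hne ⟨i, by simp; omega⟩
    omega

theorem alt_sum {n : ℕ} (f : Fin n → ℤ) (b : ℤ) (hf : Antitone f) (h0 : ∀ i, 0 ≤ f i)
    (hb : ∀ i, f i ≤ b) (hb0 : 0 ≤ b) :
    0 ≤ ∑ i : Fin n, (-1) ^ (i : ℕ) * f i ∧ ∑ i : Fin n, (-1) ^ (i : ℕ) * f i ≤ b := by
  induction n generalizing b with
  | zero => simpa using hb0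
  | succ n ih =>
    have := ih (fun i => f i.succ) (f 0) (fun i j hij => hf (Fin.succ_le_succ_iff.2 hij))
      (fun i => h0 _) (fun i => hf (Fin.zero_le _)) (h0 0)
    have e : ∑ i : Fin (n+1), (-1) ^ (i : ℕ) * f i
        = f 0 - ∑ i : Fin n, (-1) ^ (i : ℕ) * f i.succ := by
      rw [Fin.sum_univ_succ, sub_eq_add_neg, ← Finset.sum_neg_distrib]
      congr 1
      · simp
      · refine Finset.sum_congr rfl ?_
        intro i _
        rw [Fin.val_succ, pow_succ]; ring
    have := hb 0
    rw [e]
    constructor <;> linarith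

theorem moves_sum {M : ℕ} (u : Fin M → ℕ) (t : ℕ) :
    defSum (evenMove u) (t+1) + defSum (oddMove u) (t+1) = defSum u (t+1) + defSum u t := by
  unfold evenMove oddMove
  rw [defSum_sortVec, defSum_sortVec]
  unfold defSum
  rw [← Finset.sum_add_distrib, ← Finset.sum_add_distrib]
  refine Finset.sum_congr rfl ?_
  intro i _
  dsimp only
  split_ifs <;> omega

theorem moves_diff {M : ℕ} (u : Fin M → ℕ) (hu : Monotone u) (t : ℕ) :
    defSum (oddMove u) (t+1) ≤ defSum (evenMove u) (t+1) ∧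
    defSum (evenMove u) (t+1) ≤ defSum (oddMove u) (t+1) + 1 := by
  have key := alt_sum (fun i => if u i ≤ t then (1:ℤ) else 0) 1
    (fun i j hij => by
      have := hu hij
      dsimp only
      split_ifs <;> omega)
    (fun i => by split_ifs <;> omega) (fun i => by split_ifs <;> omega) (by norm_num)
  have e : ∑ i : Fin M, (-1) ^ (i : ℕ) * (if u i ≤ t then (1:ℤ) else 0)
      = (defSum (evenMove u) (t+1) : ℤ) - defSum (oddMove u) (t+1) := by
    unfold evenMove oddMove
    rw [defSum_sortVec, defSum_sortVec]
    unfold defSum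
    push_cast
    rw [← Finset.sum_sub_distrib]
    refine Finset.sum_congr rfl ?_
    intro i _
    rcases Nat.even_or_odd (i : ℕ) with h | h
    · have h' := Nat.even_iff.1 h
      rw [h.neg_one_pow]
      by_cases hc : u i ≤ t <;> simp [h', hc] <;> omega
    · have h' := Nat.odd_iff.1 h
      rw [h.neg_one_pow]
      by_cases hc : u i ≤ t <;> simp [h', hc] <;> omega
  rw [e] at key
  omega

theorem defSum_zero {M : ℕ} (w : Fin M → ℕ) : defSum w 0 = 0 := by
  simp [defSum]

theorem sortVec_mono {M : ℕ} (w : Fin M → ℕ) : Monotone (sortVec w) := Tuple.monotone_sort w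

theorem even_odd_monotone {M : ℕ} (u v : Fin M → ℕ)
    (hu : Monotone u) (hv : Monotone v) :
    PosLE (evenMove u) (oddMove u) ∧
    (PosLE u v → PosLE (evenMove u) (evenMove v)) ∧
    (PosLE u v → PosLE (oddMove u) (oddMove v)) := by
  refine ⟨?_, fun h => ?_, fun h => ?_⟩ <;> refine posLE_of_defSum _ _ (sortVec_mono _) ?_ <;>
    rintro (_ | t)
  · simp [defSum_zero]
  · exact (moves_diff u hu t).1
  · simp [defSum_zero]
  · have := moves_diff u hu t
    have := moves_diff v hv t
    have := moves_sum u t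
    have := moves_sum v t
    have := defSum_of_posLE u v hv h t
    have := defSum_of_posLE u v hv h (t+1)
    omega
  · simp [defSum_zero]
  · have := moves_diff u hu t
    have := moves_diff v hv t
    have := moves_sum u t
    have := moves_sum v t
    have := defSum_of_posLE u v hv h t
    have := defSum_of_posLE u v hv h (t+1)
    omega
end

section
/- There exists an absolute constant C > 0 such that for every f ∈ (0,1/2) there is an N with the following property. For each integer n ≥ N set n₁ = n − ⌊(4/(1−2f)²)·log log n⌋, n₂ = n − n₁, F = ⌊fn⌋, and F₁ = ⌊f·n₁⌋ (natural logarithms). Let M be any integer with M ≥ C·√n₂·2^n/(Σ_{i=0}^{F} C(n,i)), let f_0 : ℤ → ℕ be defined by f_0(0) = M and f_0(j) = 0 for j ≠ 0, and let f_t evolve under the liar machine. Then Σ_{i=F₁}^{F} f_n(−n+2i) ≥ 1. -/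
/-- The tie-breaking sign function of the liar machine: `χ(j) = 0` if `f j` is even,
and `χ(j) = (-1)^{#{i < j : f i odd}}` if `f j` is odd. -/
noncomputable def liarChi (f : ℤ → ℕ) (j : ℤ) : ℤ :=
  if Odd (f j) then (-1 : ℤ) ^ ({i : ℤ | i < j ∧ Odd (f i)}.ncard) else 0

/-- `F` is an evolution of the liar machine:
`f_{t+1}(j) = (f_t(j-1) + f_t(j+1) + χ_t(j-1) - χ_t(j+1)) / 2`. -/
def IsLiarEvolution (F : ℕ → ℤ → ℕ) : Prop :=
  ∀ t j, (F (t + 1) j : ℤ) * 2 =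
    (F t (j - 1) : ℤ) + (F t (j + 1) : ℤ) + liarChi (F t) (j - 1) - liarChi (F t) (j + 1)

/-- `G` is an evolution of the linear machine: `g_{t+1}(j) = (g_t(j-1) + g_t(j+1)) / 2`. -/
def IsLinearEvolution (G : ℕ → ℤ → ℝ) : Prop :=
  ∀ t j, G (t + 1) j = (G t (j - 1) + G t (j + 1)) / 2


/-! ### Binomial moments -/

/-- Binomial expectation. -/
noncomputable def Eb (f : ℝ) (m : ℕ) (φ : ℕ → ℝ) : ℝ :=
  ∑ k ∈ Finset.range (m + 1), (m.choose k : ℝ) * (f ^ k * (1 - f) ^ (m - k) * φ k)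

lemma Eb_succ (f : ℝ) (m : ℕ) (φ : ℕ → ℝ) :
    Eb f (m + 1) φ = f * Eb f m (fun k => φ (k + 1)) + (1 - f) * Eb f m φ := by
  unfold Eb
  rw [Finset.sum_choose_succ_mul (fun i j => f ^ i * (1 - f) ^ j * φ i) m, add_comm,
    Finset.mul_sum, Finset.mul_sum]
  congr 1
  · apply Finset.sum_congr rfl
    intro i hi
    ring
  · apply Finset.sum_congr rfl
    intro i hi
    have : m + 1 - i = (m - i) + 1 := by
      have := Finset.mem_range.1 hi
      omega
    rw [this]
    ring

lemma Eb_one (f : ℝ) (m : ℕ) : Eb f m (fun _ => 1) = 1 := by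
  induction m with
  | zero => simp [Eb]
  | succ m ih => rw [Eb_succ, ih]; ring

lemma Eb_m1 (f : ℝ) (m : ℕ) : ∀ s : ℝ, Eb f m (fun k => ((k : ℝ) - s)) = f * m - s := by
  induction m with
  | zero => intro s; simp [Eb]
  | succ m ih =>
    intro s
    rw [Eb_succ]
    have h : (fun k : ℕ => (((k + 1 : ℕ) : ℝ) - s)) = fun k : ℕ => ((k : ℝ) - (s - 1)) := by
      funext k; push_cast; ring
    rw [h, ih, ih]; push_cast; ring

lemma Eb_m2 (f : ℝ) (m : ℕ) : ∀ s : ℝ,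
    Eb f m (fun k => ((k : ℝ) - s) ^ 2) = (f * m - s) ^ 2 + m * (f * (1 - f)) := by
  induction m with
  | zero => intro s; simp [Eb]
  | succ m ih =>
    intro s
    rw [Eb_succ]
    have h : (fun k : ℕ => (((k + 1 : ℕ) : ℝ) - s) ^ 2) = fun k : ℕ => ((k : ℝ) - (s - 1)) ^ 2 := by
      funext k; push_cast; ring
    rw [h, ih, ih]; push_cast; ring

lemma Eb_m4 (f : ℝ) (m : ℕ) : ∀ s : ℝ,
    Eb f m (fun k => ((k : ℝ) - s) ^ 4) = (f * m - s) ^ 4 + 6 * (f * m - s) ^ 2 * (m * (f * (1 - f)))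
      + 4 * (f * m - s) * (m * (f * (1 - f)) * (1 - 2 * f)) + 3 * (m * (f * (1 - f))) ^ 2
      + m * (f * (1 - f)) * (1 - 6 * (f * (1 - f))) := by
  induction m with
  | zero => intro s; simp [Eb]
  | succ m ih =>
    intro s
    rw [Eb_succ]
    have h : (fun k : ℕ => (((k + 1 : ℕ) : ℝ) - s) ^ 4) = fun k : ℕ => ((k : ℝ) - (s - 1)) ^ 4 := by
      funext k; push_cast; ring
    rw [h, ih, ih]; push_cast; ring

lemma Eb_mono (f : ℝ) (h0 : 0 < f) (h1 : f < 1) (m : ℕ) (φ ψ : ℕ → ℝ) (h : ∀ k, φ k ≤ ψ k) :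
    Eb f m φ ≤ Eb f m ψ := by
  unfold Eb
  apply Finset.sum_le_sum
  intro k _
  have : 0 < 1 - f := by linarith
  have := h k
  gcongr

lemma Eb_add (f : ℝ) (m : ℕ) (φ ψ : ℕ → ℝ) :
    Eb f m (fun k => φ k + ψ k) = Eb f m φ + Eb f m ψ := by
  unfold Eb
  rw [← Finset.sum_add_distrib]
  apply Finset.sum_congr rfl; intro k _; ring

lemma Eb_smul (f : ℝ) (m : ℕ) (c : ℝ) (φ : ℕ → ℝ) :
    Eb f m (fun k => c * φ k) = c * Eb f m φ := by
  unfold Eb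
  rw [Finset.mul_sum]
  apply Finset.sum_congr rfl; intro k _; ring

lemma quartic_bound (y : ℝ) :
    4 * y ^ 2 + (-1) * y ^ 4 + (-3.1) * y + (-0.36) ≤ 9 * (if y ≤ -(1/10) then 1 else 0) := by
  split_ifs with h
  · nlinarith [sq_nonneg (y ^ 2 - 1.63^2), sq_nonneg (y + 1.63)]
  · push Not at h
    rcases le_total y 0 with h0 | h0
    · nlinarith [mul_nonneg (neg_nonneg.2 h0) (by linarith : (0:ℝ) ≤ y + 1/10), sq_nonneg (y^2)]
    · have : 4 * y - y ^ 3 ≤ 3.1 := by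
        nlinarith [mul_nonneg h0 (sq_nonneg (y - 1.1547)), sq_nonneg (y - 1.1547)]
      nlinarith [mul_le_mul_of_nonneg_left this h0]

lemma Eb_tail (f : ℝ) (h0 : 0 < f) (h1 : f < 1) (m : ℕ) (hm : 6 ≤ (m : ℝ) * (f * (1 - f))) :
    1 / 20 ≤ Eb f m (fun k => if (k : ℝ) ≤ f * m - Real.sqrt (m * (f * (1 - f))) / 10 then 1 else 0) := by
  set v := (m : ℝ) * (f * (1 - f)) with hv
  set σ := Real.sqrt v with hσ
  have hσ2 : σ ^ 2 = v := Real.sq_sqrt (by linarith)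
  have hσ0 : 0 < σ := Real.sqrt_pos.2 (by linarith)
  have key := Eb_mono f h0 h1 m
    (fun k => 4 * ((k - f * m) / σ) ^ 2 + (-1) * ((k - f * m) / σ) ^ 4 + (-3.1) * ((k - f * m) / σ) + (-0.36))
    (fun k => 9 * (if (k : ℝ) ≤ f * m - σ / 10 then 1 else 0)) (by
      intro k
      refine (quartic_bound _).trans_eq ?_
      congr 1
      have : ((k - f * m) / σ ≤ -(1/10)) ↔ ((k : ℝ) ≤ f * m - σ / 10) := by
        rw [div_le_iff₀ hσ0]
        constructor <;> intro h <;> linarith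
      simp only [this])
  have e1 : (fun k : ℕ => 4 * (((k:ℝ) - f * m) / σ) ^ 2 + (-1) * ((k - f * m) / σ) ^ 4
      + (-3.1) * ((k - f * m) / σ) + (-0.36)) =
      fun k : ℕ => (((4 / σ ^ 2) * (((k:ℝ) - f * m)) ^ 2 + (-1 / σ ^ 4) * (k - f * m) ^ 4)
      + (-3.1 / σ) * (k - f * m)) + (-0.36) * 1 := by
    funext k
    field_simp
  rw [e1, Eb_add, Eb_add, Eb_add, Eb_smul, Eb_smul, Eb_smul, Eb_smul, Eb_smul, Eb_one, Eb_m1, Eb_m2,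
    Eb_m4] at key
  simp only [← hv, sub_self] at key
  have e2 : σ ^ 4 = v ^ 2 := by rw [← hσ2]; ring
  rw [hσ2, e2] at key
  have hv0 : 0 < v := by linarith
  have e3 : 4 / v * (0 ^ 2 + v) = 4 := by field_simp; ring
  have e4 : -1 / v ^ 2 * (0 ^ 4 + 6 * 0 ^ 2 * v + 4 * 0 * (v * (1 - 2 * f)) + 3 * v ^ 2 +
      v * (1 - 6 * (f * (1 - f)))) = -3 - (1 - 6 * (f * (1 - f))) / v := by
    field_simp; ring
  rw [e3, e4] at key
  have e5 : (1 - 6 * (f * (1 - f))) / v ≤ 1 / 6 := by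
    rw [div_le_iff₀ hv0]
    have : 0 < f * (1 - f) := mul_pos h0 (by linarith)
    linarith
  norm_num at key ⊢
  linarith

lemma choose_var (N : ℕ) :
    ∑ k ∈ Finset.range (N + 1), (N.choose k : ℝ) * (2 * (k : ℝ) - N) ^ 2 = (N : ℝ) * 2 ^ N := by
  have h := Eb_m2 (1/2) N (1/2 * N)
  unfold Eb at h
  have h2 : ∑ k ∈ Finset.range (N + 1), (N.choose k : ℝ) * (2 * (k : ℝ) - N) ^ 2 =
      4 * 2 ^ N * ∑ k ∈ Finset.range (N + 1), (N.choose k : ℝ) *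
        ((1 / 2) ^ k * (1 - 1 / 2) ^ (N - k) * ((k : ℝ) - 1 / 2 * N) ^ 2) := by
    rw [Finset.mul_sum]
    apply Finset.sum_congr rfl
    intro k hk
    have hk' : k ≤ N := by have := Finset.mem_range.1 hk; omega
    have : (1/2 : ℝ) ^ k * (1 - 1/2) ^ (N - k) * 2 ^ N = 1 := by
      norm_num
      rw [← pow_add, Nat.add_sub_cancel' hk', ← mul_pow]; norm_num
    linear_combination (-(N.choose k : ℝ) * (2 * k - N) ^ 2) * this
  rw [h2, h]
  ring

lemma choose_abs (N : ℕ) :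
    ∑ k ∈ Finset.range (N + 1), (N.choose k : ℝ) * |2 * (k : ℝ) - N| ≤ 2 ^ N * Real.sqrt N := by
  have cs := Finset.sum_mul_sq_le_sq_mul_sq (Finset.range (N + 1))
    (fun k => Real.sqrt (N.choose k : ℝ)) (fun k => Real.sqrt (N.choose k : ℝ) * |2 * (k : ℝ) - N|)
  have e1 : ∀ k : ℕ, Real.sqrt (N.choose k : ℝ) * (Real.sqrt (N.choose k : ℝ) * |2 * (k : ℝ) - N|) =
      (N.choose k : ℝ) * |2 * (k : ℝ) - N| := by
    intro k; rw [← mul_assoc, Real.mul_self_sqrt (by positivity)]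
  have e2 : ∀ k : ℕ, Real.sqrt (N.choose k : ℝ) ^ 2 = (N.choose k : ℝ) := fun k =>
    Real.sq_sqrt (by positivity)
  have e3 : ∀ k : ℕ, (Real.sqrt (N.choose k : ℝ) * |2 * (k : ℝ) - N|) ^ 2 =
      (N.choose k : ℝ) * (2 * k - N) ^ 2 := by
    intro k; rw [mul_pow, e2, sq_abs]
  simp only [e1, e2, e3] at cs
  rw [choose_var] at cs
  have e4 : ∑ k ∈ Finset.range (N + 1), (N.choose k : ℝ) = 2 ^ N := by
    exact_mod_cast Nat.sum_range_choose N
  rw [e4] at cs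
  apply abs_le_of_sq_le_sq' _ (by positivity) |>.2
  rw [mul_pow, Real.sq_sqrt (by positivity)]
  linarith

/-! ### Averaging operator -/

/-- Averaging. -/
noncomputable def Pop (w : ℕ → ℝ) (i : ℕ) : ℝ := (w i + w (i + 1)) / 2

/-- Difference. -/
noncomputable def Dl (w : ℕ → ℝ) (i : ℕ) : ℝ := w (i + 1) - w i

lemma Pop_iter (m : ℕ) : ∀ (w : ℕ → ℝ) (i : ℕ),
    Pop^[m] w i = ∑ k ∈ Finset.range (m + 1), (m.choose k : ℝ) * (w (i + k) / 2 ^ m) := by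
  induction m with
  | zero => intro w i; simp
  | succ m ih =>
    intro w i
    rw [Function.iterate_succ_apply', Pop, ih, ih,
      Finset.sum_choose_succ_mul (fun k _ => w (i + k) / 2 ^ (m + 1)) m,
      ← Finset.sum_add_distrib, ← Finset.sum_add_distrib, Finset.sum_div]
    apply Finset.sum_congr rfl
    intro k _
    rw [show i + 1 + k = i + (k + 1) by ring]
    field_simp
    ring

lemma Dl_Pop (w : ℕ → ℝ) : Dl (Pop w) = Pop (Dl w) := by
  funext i; simp only [Dl, Pop]; ring

lemma Dl_Pop_iter (m : ℕ) (w : ℕ → ℝ) : Dl (Pop^[m] w) = Pop^[m] (Dl w) := by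
  induction m with
  | zero => rfl
  | succ m ih => rw [Function.iterate_succ_apply', Dl_Pop, ih, Function.iterate_succ_apply']

lemma Pop_zero {K : ℕ} (w : ℕ → ℝ) (hw : ∀ i, K ≤ i → w i = 0) : ∀ i, K ≤ i → Pop w i = 0 := by
  intro i hi; simp [Pop, hw i hi, hw (i + 1) (by omega)]

lemma Dl_zero {K : ℕ} (w : ℕ → ℝ) (hw : ∀ i, K ≤ i → w i = 0) : ∀ i, K ≤ i → Dl w i = 0 := by
  intro i hi; simp [Dl, hw i hi, hw (i + 1) (by omega)]

lemma Pop_iter_zero {K : ℕ} (m : ℕ) (w : ℕ → ℝ) (hw : ∀ i, K ≤ i → w i = 0) :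
    ∀ i, K ≤ i → Pop^[m] w i = 0 := by
  induction m with
  | zero => exact hw
  | succ m ih => rw [Function.iterate_succ_apply']; exact Pop_zero _ ih

lemma shift_norm {K : ℕ} (w : ℕ → ℝ) (hw : ∀ i, K ≤ i → w i = 0) (k : ℕ) :
    ∑ i ∈ Finset.range K, |w (i + k)| ≤ ∑ i ∈ Finset.range K, |w i| := by
  induction k with
  | zero => simp
  | succ k ih =>
    refine le_trans ?_ ih
    have h1 := Finset.sum_range_succ' (fun i => |w (i + k)|) K
    rw [Finset.sum_range_succ, hw (K + k) (by omega)] at h1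
    have h2 : ∑ i ∈ Finset.range K, |w (i + (k + 1))| = ∑ i ∈ Finset.range K, |w (i + 1 + k)| :=
      Finset.sum_congr rfl (fun i _ => by rw [show i + (k + 1) = i + 1 + k by ring])
    rw [h2]
    have := abs_nonneg (w (0 + k))
    simp only [abs_zero] at h1
    linarith

lemma Dl_Pop_formula (m : ℕ) (w : ℕ → ℝ) (i : ℕ) :
    Dl (Pop^[m] w) i = ∑ k ∈ Finset.range (m + 1 + 1),
      ((m + 1).choose k : ℝ) * (((2 * (k : ℝ) - (m + 1 : ℕ)) / ((m + 1) * 2 ^ m)) * w (i + k)) := by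
  rw [Dl, Pop_iter, Pop_iter]
  have hA : ∑ k ∈ Finset.range (m + 1), (m.choose k : ℝ) * (w (i + 1 + k) / 2 ^ m) =
      ∑ k ∈ Finset.range (m + 1 + 1), (((m + 1).choose k : ℝ) * k / (m + 1)) * (w (i + k) / 2 ^ m) := by
    rw [Finset.sum_range_succ' _ (m + 1)]
    simp only [Nat.cast_zero, mul_zero, zero_div, zero_mul, add_zero]
    apply Finset.sum_congr rfl
    intro k _
    rw [show i + 1 + k = i + (k + 1) by ring]
    have h := Nat.add_one_mul_choose_eq m k
    have h' : ((m : ℝ) + 1) * m.choose k = (m + 1).choose (k + 1) * (k + 1) := by exact_mod_cast h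
    congr 1
    push_cast
    rw [← h']
    field_simp
  have hB : ∑ k ∈ Finset.range (m + 1), (m.choose k : ℝ) * (w (i + k) / 2 ^ m) =
      ∑ k ∈ Finset.range (m + 1 + 1), (((m + 1).choose k : ℝ) * ((m + 1) - k) / (m + 1)) * (w (i + k) / 2 ^ m) := by
    rw [Finset.sum_range_succ _ (m + 1)]
    have : ((m : ℝ) + 1 - ((m + 1 : ℕ) : ℝ)) = 0 := by push_cast; ring
    rw [this]
    simp only [mul_zero, zero_div, zero_mul, add_zero]
    apply Finset.sum_congr rfl
    intro k hk
    have hk' : k ≤ m := by have := Finset.mem_range.1 hk; omega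
    have h := Nat.choose_mul_succ_eq m k
    have h' : (m.choose k : ℝ) * (m + 1) = (m + 1).choose k * ((m + 1) - k) := by
      have h2 : ((m.choose k * (m + 1) : ℕ) : ℝ) = (((m + 1).choose k * (m + 1 - k) : ℕ) : ℝ) := by
        exact_mod_cast h
      rw [Nat.cast_mul, Nat.cast_mul, Nat.cast_sub (by omega)] at h2
      push_cast at h2
      exact h2
    congr 1
    rw [← h']
    field_simp
  rw [hA, hB, ← Finset.sum_sub_distrib]
  apply Finset.sum_congr rfl
  intro k _
  push_cast
  field_simp
  ring

lemma Dl_Pop_norm {K : ℕ} (m : ℕ) (w : ℕ → ℝ) (hw : ∀ i, K ≤ i → w i = 0) :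
    ∑ i ∈ Finset.range K, |Dl (Pop^[m] w) i| ≤
      2 / Real.sqrt (m + 1) * ∑ i ∈ Finset.range K, |w i| := by
  have hW : 0 ≤ ∑ i ∈ Finset.range K, |w i| := Finset.sum_nonneg (fun _ _ => abs_nonneg _)
  calc ∑ i ∈ Finset.range K, |Dl (Pop^[m] w) i|
      ≤ ∑ i ∈ Finset.range K, ∑ k ∈ Finset.range (m + 1 + 1),
        ((m + 1).choose k : ℝ) * ((|2 * (k : ℝ) - (m + 1 : ℕ)| / ((m + 1) * 2 ^ m)) * |w (i + k)|) := by
        apply Finset.sum_le_sum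
        intro i _
        rw [Dl_Pop_formula]
        refine (Finset.abs_sum_le_sum_abs _ _).trans_eq ?_
        apply Finset.sum_congr rfl
        intro k _
        rw [abs_mul, abs_mul, abs_div, abs_of_nonneg (by positivity : (0:ℝ) ≤ ((m + 1).choose k : ℝ)),
          abs_of_nonneg (by positivity : (0:ℝ) ≤ ((m:ℝ) + 1) * 2 ^ m)]
    _ = ∑ k ∈ Finset.range (m + 1 + 1), (((m + 1).choose k : ℝ) * |2 * (k : ℝ) - (m + 1 : ℕ)|)
          / ((m + 1) * 2 ^ m) * ∑ i ∈ Finset.range K, |w (i + k)| := by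
        rw [Finset.sum_comm]
        apply Finset.sum_congr rfl
        intro k _
        rw [Finset.mul_sum]
        apply Finset.sum_congr rfl
        intro i _
        ring
    _ ≤ ∑ k ∈ Finset.range (m + 1 + 1), (((m + 1).choose k : ℝ) * |2 * (k : ℝ) - (m + 1 : ℕ)|)
          / ((m + 1) * 2 ^ m) * ∑ i ∈ Finset.range K, |w i| := by
        apply Finset.sum_le_sum
        intro k _
        exact mul_le_mul_of_nonneg_left (shift_norm w hw k) (by positivity)
    _ = (∑ k ∈ Finset.range (m + 1 + 1), (((m + 1).choose k : ℝ) * |2 * (k : ℝ) - (m + 1 : ℕ)|))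
          / ((m + 1) * 2 ^ m) * ∑ i ∈ Finset.range K, |w i| := by
        rw [← Finset.sum_mul, Finset.sum_div]
    _ ≤ (2 ^ (m + 1) * Real.sqrt ((m + 1 : ℕ) : ℝ)) / ((m + 1) * 2 ^ m) * ∑ i ∈ Finset.range K, |w i| := by
        gcongr
        exact choose_abs (m + 1)
    _ = 2 / Real.sqrt (m + 1) * ∑ i ∈ Finset.range K, |w i| := by
        congr 1
        have hs : Real.sqrt ((m : ℝ) + 1) ^ 2 = m + 1 := Real.sq_sqrt (by positivity)
        have hs0 : 0 < Real.sqrt ((m : ℝ) + 1) := Real.sqrt_pos.2 (by positivity)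
        push_cast
        rw [div_eq_div_iff (by positivity) hs0.ne']
        rw [pow_succ]
        linear_combination (2 ^ m * 2) * hs

lemma DlDl_Pop_norm {K : ℕ} (m : ℕ) (w : ℕ → ℝ) (hw : ∀ i, K ≤ i → w i = 0) :
    ∑ i ∈ Finset.range K, |Dl (Dl (Pop^[m] w)) i| ≤
      8 / (m + 1) * ∑ i ∈ Finset.range K, |w i| := by
  have hW : 0 ≤ ∑ i ∈ Finset.range K, |w i| := Finset.sum_nonneg (fun _ _ => abs_nonneg _)
  set p := m / 2 with hp
  set q := m - p with hq
  have hm : m = p + q := by omega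
  have e : Dl (Dl (Pop^[m] w)) = Dl (Pop^[p] (Dl (Pop^[q] w))) := by
    rw [hm, Function.iterate_add_apply, Dl_Pop_iter p (Pop^[q] w)]
  rw [e]
  refine (Dl_Pop_norm p _ (Dl_zero _ (Pop_iter_zero q w hw))).trans ?_
  have h2 := Dl_Pop_norm q w hw
  refine (mul_le_mul_of_nonneg_left h2 (by positivity)).trans ?_
  rw [← mul_assoc]
  apply mul_le_mul_of_nonneg_right _ hW
  rw [div_mul_div_comm, ← Real.sqrt_mul (by positivity)]
  have hpr : ((m : ℝ) + 1) / 2 ≤ p + 1 := by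
    have : m + 1 ≤ 2 * (p + 1) := by omega
    have : ((m : ℝ) + 1) ≤ 2 * (p + 1) := by exact_mod_cast this
    linarith
  have hqr : ((m : ℝ) + 1) / 2 ≤ q + 1 := by
    have : m + 1 ≤ 2 * (q + 1) := by omega
    have : ((m : ℝ) + 1) ≤ 2 * (q + 1) := by exact_mod_cast this
    linarith
  have hs : ((m : ℝ) + 1) / 2 ≤ Real.sqrt (((p : ℝ) + 1) * (q + 1)) := by
    apply Real.le_sqrt_of_sq_le
    rw [sq]
    gcongr
  have hm0 : (0 : ℝ) < (m + 1) / 2 := by positivity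
  rw [div_le_div_iff₀ (by linarith) (by positivity)]
  linarith

/-! ### The liar machine on ℕ -/

lemma liar_support (M : ℕ) (F : ℕ → ℤ → ℕ) (h0 : ∀ j : ℤ, F 0 j = if j = 0 then M else 0)
    (hF : IsLiarEvolution F) (t : ℕ) : ∀ j : ℤ, F t j ≠ 0 → ∃ i : ℕ, j = -(t : ℤ) + 2 * (i : ℤ) := by
  induction t with
  | zero =>
    intro j hj
    rw [h0] at hj
    split_ifs at hj with h
    · exact ⟨0, by simp [h]⟩
    · exact absurd rfl hj
  | succ t ih =>
    intro j hj
    by_cases h1 : F t (j - 1) = 0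
    · by_cases h2 : F t (j + 1) = 0
      · exfalso
        apply hj
        have := hF t j
        simp [liarChi, h1, h2] at this
        exact this
      · obtain ⟨i, hi⟩ := ih _ h2
        exact ⟨i, by push_cast; omega⟩
    · obtain ⟨i, hi⟩ := ih _ h1
      exact ⟨i + 1, by push_cast; omega⟩

lemma liarChi_eq (t : ℕ) (g : ℤ → ℕ) (hg : ∀ j : ℤ, g j ≠ 0 → ∃ i : ℕ, j = -(t : ℤ) + 2 * (i : ℤ))
    (i : ℕ) : liarChi g (-(t : ℤ) + 2 * (i : ℤ)) =
      if Odd (g (-(t : ℤ) + 2 * (i : ℤ))) then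
        (-1 : ℤ) ^ ((Finset.range i).filter (fun l : ℕ => Odd (g (-(t : ℤ) + 2 * (l : ℤ))))).card
      else 0 := by
  unfold liarChi
  congr 2
  have : {j : ℤ | j < -(t : ℤ) + 2 * (i : ℤ) ∧ Odd (g j)} = (fun l : ℕ => -(t : ℤ) + 2 * (l : ℤ)) ''
      (((Finset.range i).filter (fun l : ℕ => Odd (g (-(t : ℤ) + 2 * (l : ℤ)))) : Finset ℕ) : Set ℕ) := by
    ext j
    simp only [Set.mem_ofPred_eq, Set.mem_image, Finset.coe_filter, Finset.mem_range]
    constructor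
    · rintro ⟨h1, h2⟩
      obtain ⟨l, rfl⟩ := hg j (by rintro h; rw [h] at h2; simp at h2)
      exact ⟨l, ⟨by omega, h2⟩, rfl⟩
    · rintro ⟨l, ⟨h1, h2⟩, rfl⟩
      exact ⟨by omega, h2⟩
  rw [this, Set.ncard_image_of_injective _ (by intro a b h; simpa using h), Set.ncard_coe_finset]

lemma chi_partial (b : ℕ → ℕ) (i : ℕ) :
    2 * ∑ l ∈ Finset.range i, (if Odd (b l) then
        (-1 : ℤ) ^ ((Finset.range l).filter (fun l : ℕ => Odd (b l))).card else 0) =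
      1 - (-1 : ℤ) ^ ((Finset.range i).filter (fun l : ℕ => Odd (b l))).card := by
  induction i with
  | zero => simp
  | succ i ih =>
    rw [Finset.sum_range_succ, mul_add, ih, Finset.range_add_one, Finset.filter_insert]
    split_ifs with h
    · rw [Finset.card_insert_of_notMem (by simp), pow_succ]; ring
    · simp

/-- Abstract liar dynamics on ℕ. -/
structure LiarN (a : ℕ → ℕ → ℝ) (x : ℕ → ℕ → ℝ) : Prop where
  zero : ∀ t, 2 * a (t + 1) 0 = a t 0 - x t 0
  succ : ∀ t i, 2 * a (t + 1) (i + 1) = a t i + a t (i + 1) + x t i - x t (i + 1)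
  part : ∀ t i, |∑ l ∈ Finset.range i, x t l| ≤ 1

lemma liar_to_N (M : ℕ) (F : ℕ → ℤ → ℕ) (h0 : ∀ j : ℤ, F 0 j = if j = 0 then M else 0)
    (hF : IsLiarEvolution F) :
    LiarN (fun t i => (F t (-(t : ℤ) + 2 * (i : ℤ)) : ℝ))
      (fun t i => (liarChi (F t) (-(t : ℤ) + 2 * (i : ℤ)) : ℝ)) := by
  have hs := liar_support M F h0 hF
  refine ⟨?_, ?_, ?_⟩
  · intro t
    have h := hF t (-((t + 1 : ℕ) : ℤ) + 2 * ((0 : ℕ) : ℤ))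
    have e1 : (-((t + 1 : ℕ) : ℤ) + 2 * ((0 : ℕ) : ℤ)) + 1 = -(t : ℤ) + 2 * ((0 : ℕ) : ℤ) := by
      push_cast; ring
    have e2 : F t ((-((t + 1 : ℕ) : ℤ) + 2 * ((0 : ℕ) : ℤ)) - 1) = 0 := by
      by_contra hne
      obtain ⟨i, hi⟩ := hs t _ hne
      push_cast at hi
      omega
    have e3 : liarChi (F t) ((-((t + 1 : ℕ) : ℤ) + 2 * ((0 : ℕ) : ℤ)) - 1) = 0 := by
      unfold liarChi; rw [e2]; simp
    rw [e1, e2, e3] at h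
    have h' := congrArg (fun z : ℤ => (z : ℝ)) h
    push_cast at h' ⊢
    linarith
  · intro t i
    have h := hF t (-((t + 1 : ℕ) : ℤ) + 2 * ((i + 1 : ℕ) : ℤ))
    have e1 : (-((t + 1 : ℕ) : ℤ) + 2 * ((i + 1 : ℕ) : ℤ)) + 1 = -(t : ℤ) + 2 * ((i + 1 : ℕ) : ℤ) := by
      push_cast; ring
    have e2 : (-((t + 1 : ℕ) : ℤ) + 2 * ((i + 1 : ℕ) : ℤ)) - 1 = -(t : ℤ) + 2 * (i : ℤ) := by
      push_cast; ring
    rw [e1, e2] at h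
    have h' := congrArg (fun z : ℤ => (z : ℝ)) h
    simp only [Int.cast_mul, Int.cast_sub, Int.cast_add, Int.cast_natCast, Int.cast_ofNat] at h'
    linarith
  · intro t i
    have h := chi_partial (fun l => F t (-(t : ℤ) + 2 * (l : ℤ))) i
    simp only [← liarChi_eq t (F t) (hs t)] at h
    have h1 : |∑ l ∈ Finset.range i, liarChi (F t) (-(t : ℤ) + 2 * (l : ℤ))| ≤ 1 := by
      rw [abs_le]
      rcases neg_one_pow_eq_or ℤ
        ((Finset.range i).filter (fun l : ℕ => Odd (F t (-(t : ℤ) + 2 * (l : ℤ))))).card with e | e <;>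
      rw [e] at h <;> constructor <;> omega
    exact_mod_cast h1

lemma abel_bound {K : ℕ} (x u : ℕ → ℝ) (hu : ∀ i, K ≤ i → u i = 0)
    (hx : ∀ i, |∑ l ∈ Finset.range i, x l| ≤ 1) :
    |∑ i ∈ Finset.range K, u i * x i| ≤ ∑ i ∈ Finset.range K, |Dl u i| := by
  have key : ∀ n, ∑ i ∈ Finset.range n, u i * x i = u n * ∑ l ∈ Finset.range n, x l -
      ∑ i ∈ Finset.range n, Dl u i * ∑ l ∈ Finset.range (i + 1), x l := by
    intro n
    induction n with
    | zero => simp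
    | succ n ih =>
      rw [Finset.sum_range_succ, ih, Finset.sum_range_succ (fun i => Dl u i * _),
        Finset.sum_range_succ x n, Dl]
      ring
  rw [key, hu K le_rfl, zero_mul, zero_sub, abs_neg]
  refine (Finset.abs_sum_le_sum_abs _ _).trans ?_
  apply Finset.sum_le_sum
  intro i _
  rw [abs_mul]
  exact mul_le_of_le_one_right (abs_nonneg _) (hx _)

lemma liar_step {a x : ℕ → ℕ → ℝ} (h : LiarN a x) {K : ℕ} (w : ℕ → ℝ) (hw : ∀ i, K ≤ i → w i = 0)
    (t : ℕ) : ∑ i ∈ Finset.range K, w i * a (t + 1) i =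
      ∑ i ∈ Finset.range K, Pop w i * a t i + (1 / 2) * ∑ i ∈ Finset.range K, Dl w i * x t i := by
  have key : ∀ n, ∑ i ∈ Finset.range (n + 1), w i * a (t + 1) i =
      ∑ i ∈ Finset.range n, Pop w i * a t i + (1 / 2) * ∑ i ∈ Finset.range n, Dl w i * x t i
      + w n * (a t n - x t n) / 2 := by
    intro n
    induction n with
    | zero =>
      simp
      linear_combination (w 0 / 2) * h.zero t
    | succ n ih =>
      rw [Finset.sum_range_succ, ih, Finset.sum_range_succ _ n, Finset.sum_range_succ _ n, Pop, Dl]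
      linear_combination (w (n + 1) / 2) * h.succ t n
  have := key K
  rw [Finset.sum_range_succ, hw K le_rfl] at this
  linarith

lemma liar_disc {a x : ℕ → ℕ → ℝ} (h : LiarN a x) {K : ℕ} (t m : ℕ) :
    ∀ (w : ℕ → ℝ), (∀ i, K ≤ i → w i = 0) →
    |∑ i ∈ Finset.range K, w i * a (t + m) i - ∑ i ∈ Finset.range K, Pop^[m] w i * a t i| ≤
      ∑ s ∈ Finset.range m, (1 / 2) * ∑ i ∈ Finset.range K, |Dl (Dl (Pop^[s] w)) i| := by
  induction m with
  | zero => intro w _; simp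
  | succ m ih =>
    intro w hw
    have h1 := ih (Pop w) (Pop_zero w hw)
    have h2 := liar_step h w hw (t + m)
    have h3 := abel_bound (x (t + m)) (Dl w) (Dl_zero w hw) (h.part _)
    rw [Finset.sum_range_succ', ← add_assoc, h2]
    simp only [Function.iterate_succ_apply, Function.iterate_zero_apply]
    rw [abs_le] at h1 h3 ⊢
    constructor <;> linarith [h1.1, h1.2, h3.1, h3.2]

lemma sum_inv_sqrt (m : ℕ) : ∑ s ∈ Finset.range m, 1 / Real.sqrt ((s : ℝ) + 1) ≤ 2 * Real.sqrt m := by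
  induction m with
  | zero => simp
  | succ m ih =>
    rw [Finset.sum_range_succ]
    push_cast
    have h1 : Real.sqrt ((m : ℝ) + 1) ^ 2 = m + 1 := Real.sq_sqrt (by positivity)
    have h2 : Real.sqrt (m : ℝ) ^ 2 = m := Real.sq_sqrt (by positivity)
    have h0 : 0 < Real.sqrt ((m : ℝ) + 1) := Real.sqrt_pos.2 (by positivity)
    have h3 : 1 / Real.sqrt ((m : ℝ) + 1) ≤ 2 * Real.sqrt ((m : ℝ) + 1) - 2 * Real.sqrt m := by
      rw [div_le_iff₀ h0]
      nlinarith [sq_nonneg (Real.sqrt ((m : ℝ) + 1) - Real.sqrt m)]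
    linarith

lemma sum_inv (m : ℕ) : ∑ s ∈ Finset.range m, 1 / ((s : ℝ) + 1) ≤ 1 + Real.log m := by
  have := harmonic_le_one_add_log m
  rw [harmonic] at this
  push_cast at this
  simpa using this

/-- Pointwise discrepancy. -/
lemma pointwise_disc {a x : ℕ → ℕ → ℝ} (h : LiarN a x) (m c : ℕ) (M : ℝ)
    (h0 : ∀ i, a 0 i = if i = 0 then M else 0) :
    M * (m.choose c : ℝ) / 2 ^ m - 4 * (1 + Real.log m) ≤ a m c := by
  set w : ℕ → ℝ := fun i => if i = c then 1 else 0 with hwdef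
  have hw : ∀ i, c + 1 ≤ i → w i = 0 := by
    intro i hi; simp only [hwdef]; rw [if_neg (by omega)]
  have key := liar_disc h 0 m w hw
  have e1 : ∑ i ∈ Finset.range (c + 1), w i * a (0 + m) i = a m c := by
    simp [hwdef]
  have e2 : ∑ i ∈ Finset.range (c + 1), Pop^[m] w i * a 0 i = M * (m.choose c : ℝ) / 2 ^ m := by
    rw [Finset.sum_eq_single_of_mem 0 (by simp) (by intro i _ hi; rw [h0, if_neg hi, mul_zero]),
      h0, if_pos rfl, Pop_iter]
    rcases le_or_gt c m with hc | hc
    · rw [Finset.sum_eq_single_of_mem c (by simp; omega)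
        (by intro i _ hi; simp [hwdef, hi])]
      simp [hwdef]; ring
    · rw [Nat.choose_eq_zero_of_lt hc, Finset.sum_eq_zero]
      · simp
      · intro i hi
        have := Finset.mem_range.1 hi
        simp only [hwdef]
        rw [if_neg (by omega)]; simp
  have e3 : ∑ i ∈ Finset.range (c + 1), |w i| = 1 := by
    rw [Finset.sum_eq_single_of_mem c (by simp) (by intro i _ hi; simp [hwdef, hi])]
    simp [hwdef]
  rw [e1, e2] at key
  have b : ∑ s ∈ Finset.range m, (1 / 2) * ∑ i ∈ Finset.range (c + 1), |Dl (Dl (Pop^[s] w)) i| ≤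
      4 * (1 + Real.log m) := by
    refine le_trans ?_ (mul_le_mul_of_nonneg_left (sum_inv m) (by norm_num))
    rw [Finset.mul_sum]
    apply Finset.sum_le_sum
    intro s _
    have := DlDl_Pop_norm s w hw
    rw [e3] at this
    calc _ ≤ (1 / 2) * (8 / ((s : ℝ) + 1) * 1) := by gcongr
      _ = _ := by ring
  have := (abs_le.1 (key.trans b)).1
  linarith

/-- Interval discrepancy. -/
lemma interval_disc {a x : ℕ → ℕ → ℝ} (h : LiarN a x) (t m A B : ℕ) :
    ∑ i ∈ Finset.range (B + 1), Pop^[m] (fun i => if A ≤ i ∧ i ≤ B then 1 else 0) i * a t i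
      - 4 * Real.sqrt m ≤ ∑ i ∈ Finset.Icc A B, a (t + m) i := by
  set w : ℕ → ℝ := fun i => if A ≤ i ∧ i ≤ B then 1 else 0 with hwdef
  have hw : ∀ i, B + 1 ≤ i → w i = 0 := by
    intro i hi; simp only [hwdef]; rw [if_neg (by omega)]
  have key := liar_disc h t m w hw
  have e1 : ∑ i ∈ Finset.range (B + 1), w i * a (t + m) i = ∑ i ∈ Finset.Icc A B, a (t + m) i := by
    simp only [hwdef, ite_mul, one_mul, zero_mul]
    rw [← Finset.sum_filter]
    apply Finset.sum_congr _ (fun _ _ => rfl)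
    ext i
    simp only [Finset.mem_filter, Finset.mem_range, Finset.mem_Icc]
    omega
  have e3 : ∑ i ∈ Finset.range (B + 1), |Dl w i| ≤ 2 := by
    have : ∀ i ∈ Finset.range (B + 1), |Dl w i| ≤ (if i + 1 = A then 1 else 0) + (if i = B then 1 else 0) := by
      intro i _
      simp only [Dl, hwdef]
      split_ifs <;> first | omega | norm_num
    refine (Finset.sum_le_sum this).trans ?_
    rw [Finset.sum_add_distrib]
    have h1 : ∑ i ∈ Finset.range (B + 1), (if i = B then (1:ℝ) else 0) ≤ 1 := by simp
    have h2 : ∑ i ∈ Finset.range (B + 1), (if i + 1 = A then (1:ℝ) else 0) ≤ 1 := by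
      rw [Finset.sum_ite, Finset.sum_const_zero, add_zero, Finset.sum_const, nsmul_eq_mul, mul_one]
      have : ((Finset.range (B + 1)).filter (fun i => i + 1 = A)).card ≤ 1 := by
        rw [Finset.card_le_one]
        intro p hp q hq
        simp at hp hq
        omega
      exact_mod_cast this
    linarith
  rw [e1] at key
  have b : ∑ s ∈ Finset.range m, (1 / 2) * ∑ i ∈ Finset.range (B + 1), |Dl (Dl (Pop^[s] w)) i| ≤
      2 * (2 * Real.sqrt m) := by
    refine le_trans ?_ (mul_le_mul_of_nonneg_left (sum_inv_sqrt m) (by norm_num))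
    rw [Finset.mul_sum]
    apply Finset.sum_le_sum
    intro s _
    have := Dl_Pop_norm s (Dl w) (Dl_zero w hw)
    rw [Dl_Pop_iter s w]
    calc _ ≤ (1 / 2) * (2 / Real.sqrt ((s : ℝ) + 1) * ∑ i ∈ Finset.range (B + 1), |Dl w i|) := by gcongr
      _ ≤ (1 / 2) * (2 / Real.sqrt ((s : ℝ) + 1) * 2) := by gcongr
      _ = _ := by ring
  have := (abs_le.1 (key.trans b)).1
  linarith

/-! ### Binomial coefficient estimates -/

/-- Tilted binomial coefficient. -/
noncomputable def qq (r : ℝ) (ν i : ℕ) : ℝ := (ν.choose i : ℝ) * r ^ i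

lemma qq_nonneg {r : ℝ} (hr : 0 < r) (ν i : ℕ) : 0 ≤ qq r ν i := by
  unfold qq; positivity

lemma qq_succ (f : ℝ) (h1 : f < 1) (ν i : ℕ) :
    ((1 - f) * (i + 1)) * qq (f / (1 - f)) ν (i + 1) = (f * (ν - i)) * qq (f / (1 - f)) ν i := by
  have hf : 1 - f ≠ 0 := by linarith
  have h : (ν.choose (i + 1) : ℝ) * (i + 1) = ν.choose i * (ν - i) := by
    rcases le_or_gt i ν with hi | hi
    · have := Nat.choose_succ_right_eq ν i
      have h2 : ((ν.choose (i + 1) * (i + 1) : ℕ) : ℝ) = ((ν.choose i * (ν - i) : ℕ) : ℝ) := by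
        exact_mod_cast this
      rw [Nat.cast_mul, Nat.cast_mul, Nat.cast_sub hi] at h2
      push_cast at h2
      exact h2
    · rw [Nat.choose_eq_zero_of_lt hi, Nat.choose_eq_zero_of_lt (by omega)]; simp
  unfold qq
  rw [pow_succ]
  have e : (1 - f) * (f / (1 - f)) = f := by field_simp
  linear_combination (f / (1 - f)) ^ i * f * h +
    (ν.choose (i + 1) : ℝ) * (i + 1) * (f / (1 - f)) ^ i * e

lemma qq_upper (f : ℝ) (h0 : 0 < f) (h1' : f < 1 / 2) (ν a : ℕ) (ha1 : (a : ℝ) ≤ f * ν)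
    (ha2 : f * ν < a + 1) (i : ℕ) :
    qq (f / (1 - f)) ν i ≤ 2 * qq (f / (1 - f)) ν a := by
  have h1 : f < 1 := by linarith
  have hf : 0 < 1 - f := by linarith
  have hr : 0 < f / (1 - f) := by positivity
  have hqa := qq_nonneg hr ν a
  have hdown : ∀ d, d ≤ a → qq (f / (1 - f)) ν (a - d) ≤ qq (f / (1 - f)) ν a := by
    intro d
    induction d with
    | zero => intro _; simp
    | succ d ih =>
      intro hd
      refine le_trans ?_ (ih (by omega))
      have hs := qq_succ f h1 ν (a - (d + 1))
      have e : a - (d + 1) + 1 = a - d := by omega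
      rw [e] at hs
      have e' : ((a - (d + 1) : ℕ) : ℝ) = a - (d + 1) := by
        rw [Nat.cast_sub hd]; push_cast; ring
      rw [e'] at hs
      have hd' : (d : ℝ) + 1 ≤ a := by exact_mod_cast hd
      have hd0 : (0 : ℝ) ≤ d := by positivity
      have hc : (1 - f) * ((a : ℝ) - (d + 1) + 1) ≤ f * (ν - (a - (d + 1))) := by nlinarith
      have hpos : 0 < (1 - f) * ((a : ℝ) - (d + 1) + 1) := mul_pos hf (by linarith)
      have hq := qq_nonneg hr ν (a - (d + 1))
      by_contra hlt
      push Not at hlt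
      have := mul_le_mul_of_nonneg_right hc hq
      have := mul_lt_mul_of_pos_left hlt hpos
      linarith
  have hup1 : qq (f / (1 - f)) ν (a + 1) ≤ 2 * qq (f / (1 - f)) ν a := by
    have hs := qq_succ f h1 ν a
    have hpos : 0 < (1 - f) * ((a : ℝ) + 1) := by positivity
    have hc : f * (ν - a) ≤ 2 * ((1 - f) * ((a : ℝ) + 1)) := by
      have : f * (ν - a) ≤ (1 - f) * (a + 1) + f := by nlinarith
      have h2 : f ≤ (1 - f) * ((a : ℝ) + 1) := by
        have : (0 : ℝ) ≤ a := by positivity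
        nlinarith
      linarith
    by_contra hlt
    push Not at hlt
    have := mul_le_mul_of_nonneg_right hc hqa
    have := mul_lt_mul_of_pos_left hlt hpos
    linarith
  have hup : ∀ d, qq (f / (1 - f)) ν (a + 1 + d) ≤ 2 * qq (f / (1 - f)) ν a := by
    intro d
    induction d with
    | zero => simpa using hup1
    | succ d ih =>
      refine le_trans ?_ ih
      have hs := qq_succ f h1 ν (a + 1 + d)
      push_cast at hs
      have hd0 : (0 : ℝ) ≤ d := by positivity
      have hc : f * (ν - ((a : ℝ) + 1 + d)) ≤ (1 - f) * ((a : ℝ) + 1 + d + 1) := by nlinarith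
      have hpos : 0 < (1 - f) * ((a : ℝ) + 1 + d + 1) := by positivity
      have hq := qq_nonneg hr ν (a + 1 + d)
      rw [← add_assoc]
      by_contra hlt
      push Not at hlt
      have := mul_le_mul_of_nonneg_right hc hq
      have := mul_lt_mul_of_pos_left hlt hpos
      linarith
  rcases le_or_gt i a with hi | hi
  · have := hdown (a - i) (by omega)
    rw [show a - (a - i) = i by omega] at this
    linarith
  · have := hup (i - (a + 1))
    rwa [show a + 1 + (i - (a + 1)) = i by omega] at this

lemma qq_lower (f : ℝ) (h0 : 0 < f) (h1 : f < 1) (ν a b : ℕ) (ha1 : (a : ℝ) ≤ f * ν)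
    (ha2 : f * ν < a + 1) (hν : 2 * ((b : ℝ) + 1) ^ 2 ≤ f * (1 - f) * ν) (d : ℕ) (hd : d ≤ b) :
    qq (f / (1 - f)) ν a / 2 ≤ qq (f / (1 - f)) ν (a + d) := by
  have hf : 0 < 1 - f := by linarith
  have hr : 0 < f / (1 - f) := by positivity
  have hqa := qq_nonneg hr ν a
  have hb0 : (0 : ℝ) ≤ b := by positivity
  have hpos0 : 0 < f * (1 - f) * ν := by nlinarith
  set δ : ℝ := (b + 1) / (f * (1 - f) * ν) with hδ
  have hδ0 : 0 ≤ δ := by positivity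
  have hδe : δ * (f * (1 - f) * ν) = b + 1 := by
    rw [hδ]; exact div_mul_cancel₀ _ hpos0.ne'
  have hδb : δ * (b + 1) ≤ 1 / 2 := by
    rw [hδ, div_mul_eq_mul_div, div_le_iff₀ hpos0]
    nlinarith
  have hδ1 : δ ≤ 1 / 2 := by nlinarith
  have key : ∀ d, d ≤ b → (1 - δ) ^ d * qq (f / (1 - f)) ν a ≤ qq (f / (1 - f)) ν (a + d) := by
    intro d
    induction d with
    | zero => intro _; simp
    | succ d ih =>
      intro hd
      have ih' := ih (by omega)
      have hs := qq_succ f h1 ν (a + d)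
      push_cast at hs
      have hd0 : (0 : ℝ) ≤ d := by positivity
      have hdb : (d : ℝ) + 1 ≤ b := by exact_mod_cast hd
      have hpos : 0 < (1 - f) * ((a : ℝ) + d + 1) := by positivity
      have hc : (1 - f) * ((a : ℝ) + d + 1) * (1 - δ) ≤ f * (ν - ((a : ℝ) + d)) := by
        have : (b : ℝ) + 1 ≤ δ * ((1 - f) * ((a : ℝ) + d + 1)) := by
          rw [← hδe]
          apply mul_le_mul_of_nonneg_left _ hδ0
          nlinarith
        nlinarith
      have hq := qq_nonneg hr ν (a + d)
      have hstep : (1 - δ) * qq (f / (1 - f)) ν (a + d) ≤ qq (f / (1 - f)) ν (a + d + 1) := by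
        by_contra hlt
        push Not at hlt
        have := mul_le_mul_of_nonneg_right hc hq
        have := mul_lt_mul_of_pos_left hlt hpos
        nlinarith
      rw [← add_assoc]
      refine le_trans ?_ hstep
      rw [pow_succ]
      have := mul_le_mul_of_nonneg_left ih' (by linarith : 0 ≤ 1 - δ)
      linarith
  refine le_trans ?_ (key d hd)
  have hB := one_add_mul_le_pow (by linarith : (-2:ℝ) ≤ -δ) d
  have hdb : (d : ℝ) ≤ b := by exact_mod_cast hd
  have : (1/2 : ℝ) ≤ (1 - δ) ^ d := by
    rw [← sub_eq_add_neg] at hB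
    nlinarith
  nlinarith

lemma sum_choose_pow_le (r : ℝ) (hr : 0 < r) (m T : ℕ) :
    ∑ k ∈ Finset.range T, (m.choose k : ℝ) * r ^ k ≤ (1 + r) ^ m := by
  have e : (1 + r) ^ m = ∑ k ∈ Finset.range (m + 1), (m.choose k : ℝ) * r ^ k := by
    rw [add_comm, add_pow]
    apply Finset.sum_congr rfl; intro k _; simp; ring
  have e2 : ∑ k ∈ Finset.range (m + 1), (m.choose k : ℝ) * r ^ k =
      ∑ k ∈ Finset.range (m + 1 + T), (m.choose k : ℝ) * r ^ k := by
    apply Finset.sum_subset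
    · intro k; simp; omega
    · intro k _ hk
      rw [Nat.choose_eq_zero_of_lt (by simpa using hk)]; simp
  rw [e, e2]
  apply Finset.sum_le_sum_of_subset_of_nonneg
  · intro k; simp; omega
  · intro k _ _; positivity

lemma vandermonde_sum (ν m F : ℕ) :
    ∑ j ∈ Finset.range (F + 1), ((ν + m).choose j : ℝ) =
      ∑ k ∈ Finset.range (F + 1), ∑ i ∈ Finset.range (F + 1 - k), (m.choose k : ℝ) * (ν.choose i : ℝ) := by
  rw [← Finset.sum_range_diag_flip]
  apply Finset.sum_congr rfl
  intro j _
  rw [add_comm ν m, Nat.add_choose_eq, Finset.Nat.sum_antidiagonal_eq_sum_range_succ_mk]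
  push_cast
  rfl

lemma B_upper (f : ℝ) (h0 : 0 < f) (h1 : f < 1 / 2) (ν m a F : ℕ) (ha1 : (a : ℝ) ≤ f * ν)
    (ha2 : f * ν < a + 1) :
    ∑ j ∈ Finset.range (F + 1), ((ν + m).choose j : ℝ) ≤
      2 * (qq (f / (1 - f)) ν a * ((1 - f) / f) ^ (F + 1) / ((1 - f) / f - 1) * (1 + f / (1 - f)) ^ m) := by
  have hf : 0 < 1 - f := by linarith
  set r := f / (1 - f) with hr_def
  set R := (1 - f) / f with hR_def
  have hr : 0 < r := by positivity
  have hR : 1 < R := by rw [hR_def, lt_div_iff₀ h0]; linarith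
  have hrR : r * R = 1 := by rw [hr_def, hR_def]; field_simp
  have hqa := qq_nonneg hr ν a
  have hC : ∀ i, (ν.choose i : ℝ) ≤ 2 * qq r ν a * R ^ i := by
    intro i
    have := qq_upper f h0 h1 ν a ha1 ha2 i
    have e : (ν.choose i : ℝ) = qq r ν i * R ^ i := by
      rw [qq, mul_assoc, ← mul_pow, hrR]; simp
    rw [e]
    have : (0:ℝ) ≤ R ^ i := by positivity
    gcongr
  rw [vandermonde_sum]
  calc _ ≤ ∑ k ∈ Finset.range (F + 1), (2 * qq r ν a * (R ^ (F + 1) / (R - 1))) * ((m.choose k : ℝ) * r ^ k) := by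
        apply Finset.sum_le_sum
        intro k hk
        have hk' : k ≤ F + 1 := by have := Finset.mem_range.1 hk; omega
        rw [← Finset.mul_sum]
        have h2 : ∑ i ∈ Finset.range (F + 1 - k), (ν.choose i : ℝ) ≤
            2 * qq r ν a * (R ^ (F + 1 - k) / (R - 1)) := by
          calc _ ≤ ∑ i ∈ Finset.range (F + 1 - k), 2 * qq r ν a * R ^ i := Finset.sum_le_sum (fun i _ => hC i)
            _ = 2 * qq r ν a * ((R ^ (F + 1 - k) - 1) / (R - 1)) := by
              rw [← Finset.mul_sum, geom_sum_eq hR.ne']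
            _ ≤ _ := by
              have : 0 < R - 1 := by linarith
              gcongr
              linarith
        have e : R ^ (F + 1) * r ^ k = R ^ (F + 1 - k) := by
          have : R ^ (F + 1) = R ^ (F + 1 - k) * R ^ k := by rw [← pow_add, Nat.sub_add_cancel hk']
          rw [this, mul_assoc, ← mul_pow, mul_comm R r, hrR]; simp
        calc _ ≤ (m.choose k : ℝ) * (2 * qq r ν a * (R ^ (F + 1 - k) / (R - 1))) := by gcongr
          _ = _ := by rw [← e]; ring
    _ = (2 * qq r ν a * (R ^ (F + 1) / (R - 1))) * ∑ k ∈ Finset.range (F + 1), ((m.choose k : ℝ) * r ^ k) := by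
        rw [Finset.mul_sum]
    _ ≤ (2 * qq r ν a * (R ^ (F + 1) / (R - 1))) * (1 + r) ^ m := by
        have : 0 < R - 1 := by linarith
        gcongr
        exact sum_choose_pow_le r hr m _
    _ = _ := by ring

lemma High_lower (f : ℝ) (h0 : 0 < f) (h1 : f < 1 / 2) (ν m a b D : ℕ) (ha1 : (a : ℝ) ≤ f * ν)
    (ha2 : f * ν < a + 1) (hν : 2 * ((b : ℝ) + 1) ^ 2 ≤ f * (1 - f) * ν)
    (hb : f * m ≤ b + 1) (hD1 : 1 ≤ D) (hD : 2 ≤ ((1 - f) / f) ^ D)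
    (hm : 6 ≤ (m : ℝ) * (f * (1 - f))) (hmD : 10 * (D : ℝ) ≤ Real.sqrt (m * (f * (1 - f)))) :
    (qq (f / (1 - f)) ν a * ((1 - f) / f) ^ (a + b + 1) / ((1 - f) / f - 1) * (1 + f / (1 - f)) ^ m) / 80
     ≤ ∑ i ∈ Finset.Icc a (a + b), ∑ k ∈ Finset.range (a + b + 1 - i), (ν.choose i : ℝ) * (m.choose k : ℝ) := by
  have hf : 0 < 1 - f := by linarith
  set r := f / (1 - f) with hr_def
  set R := (1 - f) / f with hR_def
  have hr : 0 < r := by positivity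
  have hR : 1 < R := by rw [hR_def, lt_div_iff₀ h0]; linarith
  have hR1 : 0 < R - 1 := by linarith
  have hrR : r * R = 1 := by rw [hr_def, hR_def]; field_simp
  have hqa := qq_nonneg hr ν a
  have hC : ∀ d, d ≤ b → qq r ν a / 2 * R ^ (a + d) ≤ (ν.choose (a + d) : ℝ) := by
    intro d hd
    have := qq_lower f h0 (by linarith) ν a b ha1 ha2 hν d hd
    have e : (ν.choose (a + d) : ℝ) = qq r ν (a + d) * R ^ (a + d) := by
      rw [qq, mul_assoc, ← mul_pow, hrR]; simp
    rw [e]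
    have : (0:ℝ) ≤ R ^ (a + d) := by positivity
    gcongr
  have hsw : ∑ i ∈ Finset.Icc a (a + b), ∑ k ∈ Finset.range (a + b + 1 - i), (ν.choose i : ℝ) * (m.choose k : ℝ)
      = ∑ k ∈ Finset.range (b + 1), ∑ d ∈ Finset.range (b + 1 - k), (ν.choose (a + d) : ℝ) * (m.choose k : ℝ) := by
    have e1 : Finset.Icc a (a + b) = Finset.Ico a (a + b + 1) := by
      ext i; simp only [Finset.mem_Icc, Finset.mem_Ico]; omega
    rw [e1, Finset.sum_Ico_eq_sum_range, show a + b + 1 - a = b + 1 by omega]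
    have e2 : ∀ d, a + b + 1 - (a + d) = b + 1 - d := by intro d; omega
    simp only [e2]
    apply Finset.sum_comm'
    intro x y
    simp only [Finset.mem_range]
    omega
  rw [hsw]
  have tail := Eb_tail f h0 (by linarith) m hm
  set σ := Real.sqrt (m * (f * (1 - f))) with hσ
  -- rewrite the tail in terms of r
  have tail2 : (1 + r) ^ m / 20 ≤ ∑ k ∈ Finset.range (m + 1),
      (if (k : ℝ) ≤ f * m - σ / 10 then (m.choose k : ℝ) * r ^ k else 0) := by
    have e : Eb f m (fun k => if (k : ℝ) ≤ f * m - σ / 10 then 1 else 0) * (1 + r) ^ m =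
        ∑ k ∈ Finset.range (m + 1), (if (k : ℝ) ≤ f * m - σ / 10 then (m.choose k : ℝ) * r ^ k else 0) := by
      unfold Eb
      rw [Finset.sum_mul]
      apply Finset.sum_congr rfl
      intro k hk
      have hk' : k ≤ m := by have := Finset.mem_range.1 hk; omega
      by_cases hc : (k : ℝ) ≤ f * m - σ / 10
      · simp only [if_pos hc]
        have e1 : 1 + r = 1 / (1 - f) := by rw [hr_def]; field_simp; ring
        have e2 : (1 + r) ^ m = (1 / (1 - f)) ^ k * (1 / (1 - f)) ^ (m - k) := by
          rw [e1, ← pow_add, Nat.add_sub_cancel' hk']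
        rw [e2, hr_def, div_pow, div_pow, div_pow, one_pow, one_pow]
        field_simp
      · simp only [if_neg hc, mul_zero, zero_mul]
    rw [← e]
    have : 0 < (1 + r) ^ m := by positivity
    nlinarith
  have hterm : ∀ k : ℕ, (k : ℝ) ≤ f * m - σ / 10 → k < b + 1 ∧ 2 ≤ R ^ (b + 1 - k) := by
    intro k hk
    have h2 : (k : ℝ) + D ≤ b + 1 := by linarith
    have h3 : k + D ≤ b + 1 := by exact_mod_cast h2
    refine ⟨by omega, hD.trans ?_⟩
    exact pow_le_pow_right₀ hR.le (by omega)
  have main : ∑ k ∈ Finset.range (m + 1), (qq r ν a * R ^ (a + b + 1) / (R - 1) / 4) *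
        (if (k : ℝ) ≤ f * m - σ / 10 then (m.choose k : ℝ) * r ^ k else 0) ≤
      ∑ k ∈ Finset.range (b + 1), ∑ d ∈ Finset.range (b + 1 - k), (ν.choose (a + d) : ℝ) * (m.choose k : ℝ) := by
    have e0 : ∑ k ∈ Finset.range (m + 1), (qq r ν a * R ^ (a + b + 1) / (R - 1) / 4) *
        (if (k : ℝ) ≤ f * m - σ / 10 then (m.choose k : ℝ) * r ^ k else 0) =
        ∑ k ∈ (Finset.range (m + 1)).filter (fun k : ℕ => (k : ℝ) ≤ f * m - σ / 10),
          (qq r ν a * R ^ (a + b + 1) / (R - 1) / 4) * ((m.choose k : ℝ) * r ^ k) := by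
      rw [Finset.sum_filter]
      apply Finset.sum_congr rfl
      intro k _
      split_ifs <;> simp
    rw [e0]
    have hsub : (Finset.range (m + 1)).filter (fun k : ℕ => (k : ℝ) ≤ f * m - σ / 10) ⊆ Finset.range (b + 1) := by
      intro k hk
      rw [Finset.mem_filter] at hk
      exact Finset.mem_range.2 (hterm k hk.2).1
    refine le_trans ?_ (Finset.sum_le_sum_of_subset_of_nonneg hsub
      (fun k _ _ => Finset.sum_nonneg (fun d _ => by positivity)))
    apply Finset.sum_le_sum
    intro k hk
    rw [Finset.mem_filter] at hk
    obtain ⟨hk1, hk2⟩ := hterm k hk.2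
    have h2 : qq r ν a / 2 * R ^ a * ((R ^ (b + 1 - k) - 1) / (R - 1)) ≤
        ∑ d ∈ Finset.range (b + 1 - k), (ν.choose (a + d) : ℝ) := by
      rw [← geom_sum_eq hR.ne', Finset.mul_sum]
      apply Finset.sum_le_sum
      intro d hd
      have hd' : d ≤ b := by have := Finset.mem_range.1 hd; omega
      refine le_trans (le_of_eq ?_) (hC d hd')
      rw [pow_add]; ring
    rw [← Finset.sum_mul]
    have e : R ^ (a + b + 1) * r ^ k = R ^ a * R ^ (b + 1 - k) := by
      have : R ^ (a + b + 1) = R ^ a * R ^ (b + 1 - k) * R ^ k := by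
        rw [mul_assoc, ← pow_add R (b + 1 - k), Nat.sub_add_cancel hk1.le, ← pow_add, add_assoc]
      rw [this, mul_assoc, ← mul_pow, mul_comm R r, hrR]; simp
    calc _ = qq r ν a / 2 * (R ^ a) * ((R ^ (b + 1 - k) / 2) / (R - 1)) * (m.choose k : ℝ) := by
          linear_combination (qq r ν a / (R - 1) / 4 * (m.choose k : ℝ)) * e
      _ ≤ qq r ν a / 2 * (R ^ a) * ((R ^ (b + 1 - k) - 1) / (R - 1)) * (m.choose k : ℝ) := by
          have : R ^ (b + 1 - k) / 2 ≤ R ^ (b + 1 - k) - 1 := by linarith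
          gcongr
      _ ≤ _ := by gcongr
  refine le_trans ?_ main
  rw [← Finset.mul_sum]
  calc _ = (qq r ν a * R ^ (a + b + 1) / (R - 1) / 4) * ((1 + r) ^ m / 20) := by ring
    _ ≤ _ := by gcongr

/-! ### Assembly -/

lemma entropy_bound (f : ℝ) (h0 : 0 < f) (h1 : f < 1 / 2) :
    (1 - 2 * f) ^ 2 / 2 ≤ Real.log 2 + f * Real.log f + (1 - f) * Real.log (1 - f) := by
  have hf : 0 < 1 - f := by linarith
  set x := 1 - 2 * f with hx
  have l1 := Real.log_le_sub_one_of_pos (show 0 < Real.exp (-x) / (2 * f * Real.exp (x ^ 2 / 2)) by positivity)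
  have l2 := Real.log_le_sub_one_of_pos (show 0 < Real.exp x / (2 * (1 - f) * Real.exp (x ^ 2 / 2)) by positivity)
  rw [Real.log_div (by positivity) (by positivity), Real.log_mul (by positivity) (by positivity),
    Real.log_mul (by positivity) (by positivity), Real.log_exp, Real.log_exp] at l1 l2
  have hc := Real.cosh_le_exp_half_sq x
  rw [Real.cosh_eq] at hc
  have e : f * (Real.exp (-x) / (2 * f * Real.exp (x ^ 2 / 2))) +
      (1 - f) * (Real.exp x / (2 * (1 - f) * Real.exp (x ^ 2 / 2))) ≤ 1 := by
    have : f * (Real.exp (-x) / (2 * f * Real.exp (x ^ 2 / 2))) +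
      (1 - f) * (Real.exp x / (2 * (1 - f) * Real.exp (x ^ 2 / 2))) =
      ((Real.exp x + Real.exp (-x)) / 2) / Real.exp (x ^ 2 / 2) := by
      field_simp; ring
    rw [this, div_le_one (by positivity)]
    exact hc
  have k1 := mul_le_mul_of_nonneg_left l1 h0.le
  have k2 := mul_le_mul_of_nonneg_left l2 hf.le
  have hx2 : f * (-x) + (1 - f) * x = x ^ 2 := by rw [hx]; ring
  nlinarith

lemma Pop_w_lower (m A B i : ℕ) (hi : A ≤ i) (hi2 : i ≤ B) :
    (∑ k ∈ Finset.range (B + 1 - i), (m.choose k : ℝ)) / 2 ^ m ≤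
      Pop^[m] (fun i => if A ≤ i ∧ i ≤ B then 1 else 0) i := by
  rw [Pop_iter]
  have e2 : ∑ k ∈ Finset.range (m + 1), (m.choose k : ℝ) * ((if A ≤ i + k ∧ i + k ≤ B then (1:ℝ) else 0) / 2 ^ m) =
      ∑ k ∈ Finset.range (m + 1 + (B + 1 - i)), (m.choose k : ℝ) *
        ((if A ≤ i + k ∧ i + k ≤ B then (1:ℝ) else 0) / 2 ^ m) := by
    apply Finset.sum_subset
    · intro k; simp only [Finset.mem_range]; omega
    · intro k _ hk
      rw [Nat.choose_eq_zero_of_lt (by simpa using hk)]; simp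
  rw [e2, Finset.sum_div]
  have hsub : Finset.range (B + 1 - i) ⊆ Finset.range (m + 1 + (B + 1 - i)) := by
    intro k; simp only [Finset.mem_range]; omega
  refine le_trans (Finset.sum_le_sum ?_) (Finset.sum_le_sum_of_subset_of_nonneg hsub ?_)
  · intro k hk
    have := Finset.mem_range.1 hk
    rw [if_pos (by omega)]
    exact le_of_eq (by ring)
  · intro k _ _
    split_ifs <;> simp

lemma liar_core (f : ℝ) (h0 : 0 < f) (h1 : f < 1 / 2) (ν m a b D M : ℕ) (logn : ℝ)
    (ha1 : (a : ℝ) ≤ f * ν)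
    (ha2 : f * ν < a + 1) (hν : 2 * ((b : ℝ) + 1) ^ 2 ≤ f * (1 - f) * ν)
    (hb : f * m ≤ b + 1) (hb2 : (b : ℝ) ≤ f * m + 1) (hD1 : 1 ≤ D) (hD : 2 ≤ ((1 - f) / f) ^ D)
    (hm1 : 1 ≤ m)
    (hm : 6 ≤ (m : ℝ) * (f * (1 - f))) (hmD : 10 * (D : ℝ) ≤ Real.sqrt (m * (f * (1 - f))))
    (hlog : Real.log ν ≤ logn) (hlog1 : 1 ≤ logn)
    (hmL : 2 * Real.log logn - 1 ≤ m * ((1 - 2 * f) ^ 2 / 2))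
    (hbig : 8 * (1 + logn) ≤ (((1 - f) / f - 1) * (f / (1 - f)) ^ 2 * Real.exp (-1) / 4) * logn ^ 2)
    (hM : 1600 * Real.sqrt m * 2 ^ (ν + m) / (∑ i ∈ Finset.range (a + b + 1), ((ν + m).choose i : ℝ)) ≤ M)
    (c x : ℕ → ℕ → ℝ) (hc : LiarN c x) (hc0 : ∀ i, c 0 i = if i = 0 then (M : ℝ) else 0)
    (hcn : ∀ t i, 0 ≤ c t i) :
    1 ≤ ∑ i ∈ Finset.Icc a (a + b), c (ν + m) i := by
  have hf : 0 < 1 - f := by linarith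
  have hBu := B_upper f h0 h1 ν m a (a + b) ha1 ha2
  have hH := High_lower f h0 h1 ν m a b D ha1 ha2 hν hb hD1 hD hm hmD
  have hlow := qq_lower f h0 (by linarith) ν a b ha1 ha2 hν
  have hB1 : 1 ≤ ∑ i ∈ Finset.range (a + b + 1), ((ν + m).choose i : ℝ) := by
    have : ((ν + m).choose 0 : ℝ) ≤ ∑ i ∈ Finset.range (a + b + 1), ((ν + m).choose i : ℝ) :=
      Finset.single_le_sum (f := fun i => ((ν + m).choose i : ℝ)) (fun i _ => by positivity) (by simp)
    simpa using this
  have hent := entropy_bound f h0 h1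
  set B := ∑ i ∈ Finset.range (a + b + 1), ((ν + m).choose i : ℝ) with hBdef
  set r := f / (1 - f) with hr_def
  set R := (1 - f) / f with hR_def
  have hr : 0 < r := by positivity
  have hR : 1 < R := by rw [hR_def, lt_div_iff₀ h0]; linarith
  have hR1 : 0 < R - 1 := by linarith
  have hrR : r * R = 1 := by rw [hr_def, hR_def]; field_simp
  have hr1 : r < 1 := by rw [hr_def, div_lt_one hf]; linarith
  set Z := qq r ν a * R ^ (a + b + 1) / (R - 1) * (1 + r) ^ m with hZ
  have hZ0 : 0 < Z := by linarith
  have hsm : 1 ≤ Real.sqrt m := by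
    rw [Real.one_le_sqrt]; exact_mod_cast hm1
  rw [div_le_iff₀ (by linarith)] at hM
  -- exponential estimate
  have hexp : r ^ 2 * Real.exp (-1) * logn ^ 2 ≤ 2 ^ m * r ^ (b + 1) * (1 - f) ^ m := by
    have hl0 : 0 < logn := by linarith
    have hL : 0 < r ^ 2 * Real.exp (-1) * logn ^ 2 := by positivity
    have hRr : 0 < 2 ^ m * r ^ (b + 1) * (1 - f) ^ m := by positivity
    rw [← Real.log_le_log_iff hL hRr, Real.log_mul (by positivity) (by positivity),
      Real.log_mul (by positivity) (by positivity), Real.log_mul (by positivity) (by positivity),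
      Real.log_mul (by positivity) (by positivity), Real.log_exp, Real.log_pow, Real.log_pow,
      Real.log_pow, Real.log_pow, Real.log_pow]
    have hlr : Real.log r < 0 := Real.log_neg hr hr1
    have hlr2 : Real.log r = Real.log f - Real.log (1 - f) := Real.log_div h0.ne' hf.ne'
    have k1 := mul_le_mul_of_nonneg_left hent (by positivity : (0:ℝ) ≤ m)
    have k2 : (f * m + 2) * Real.log r ≤ ((b : ℝ) + 1) * Real.log r :=
      mul_le_mul_of_nonpos_right (by linarith) hlr.le
    have k3 : (m : ℝ) * (Real.log 2 + f * Real.log f + (1 - f) * Real.log (1 - f)) =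
        m * Real.log 2 + (f * m) * Real.log r + m * Real.log (1 - f) := by rw [hlr2]; ring
    push_cast
    linarith
  -- pointwise
  have hpt : ∀ i ∈ Finset.Icc a (a + b), M * (ν.choose i : ℝ) / 2 ^ ν / 2 ≤ c ν i := by
    intro i hi
    rw [Finset.mem_Icc] at hi
    have hp := pointwise_disc hc ν i M hc0
    have hCi : qq r ν a / 2 * R ^ a ≤ (ν.choose i : ℝ) := by
      have e : (ν.choose i : ℝ) = qq r ν i * R ^ i := by
        rw [qq, mul_assoc, ← mul_pow, hrR]; simp
      rw [e]
      have := hlow (i - a) (by omega)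
      rw [show a + (i - a) = i by omega] at this
      have h3 : R ^ a ≤ R ^ i := pow_le_pow_right₀ hR.le hi.1
      have h4 := qq_nonneg hr ν i
      have h5 : 0 < R ^ a := by positivity
      gcongr
    have hMZ : 2 ^ (ν + m) ≤ M * (2 * Z) := by
      have : (2:ℝ) ^ (ν + m) ≤ 1600 * Real.sqrt m * 2 ^ (ν + m) := by
        have : (0:ℝ) < 2 ^ (ν + m) := by positivity
        nlinarith
      have : (M : ℝ) * B ≤ M * (2 * Z) := by gcongr
      linarith
    have hbig2 : 8 * (1 + logn) ≤ M * (ν.choose i : ℝ) / 2 ^ ν := by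
      refine hbig.trans ?_
      have s1 : ((R - 1) * r ^ 2 * Real.exp (-1) / 4) * logn ^ 2 ≤
          (R - 1) / 4 * (2 ^ m * r ^ (b + 1) * (1 - f) ^ m) := by
        have := mul_le_mul_of_nonneg_left hexp (by positivity : 0 ≤ (R - 1) / 4)
        linarith
      refine s1.trans ?_
      have hqa0 : 0 < qq r ν a := by
        rcases (qq_nonneg hr ν a).lt_or_eq with h | h
        · exact h
        · rw [← h] at hZ; simp at hZ; linarith
      rw [le_div_iff₀ (by positivity)]
      have e1 : (1 + r) * (1 - f) = 1 := by rw [hr_def]; field_simp; ring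
      have e1' : (1 + r) ^ m * (1 - f) ^ m = 1 := by rw [← mul_pow, e1, one_pow]
      have e2 : R ^ (a + b + 1) * r ^ (b + 1) = R ^ a := by
        rw [add_assoc, pow_add, mul_assoc, ← mul_pow, mul_comm R r, hrR, one_pow, mul_one]
      have s2 : (R - 1) / 4 * (2 ^ m * r ^ (b + 1) * (1 - f) ^ m) * 2 ^ ν =
          ((R - 1) / 4 * r ^ (b + 1) * (1 - f) ^ m) * 2 ^ (ν + m) := by rw [pow_add]; ring
      rw [s2]
      calc _ ≤ ((R - 1) / 4 * r ^ (b + 1) * (1 - f) ^ m) * (M * (2 * Z)) := by gcongr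
        _ = M * (qq r ν a / 2 * R ^ a) := by
          rw [hZ, ← e2]
          field_simp
          linear_combination (4 * (M : ℝ)) * e1'
        _ ≤ M * (ν.choose i : ℝ) := by gcongr
    linarith
  -- interval
  have hint := interval_disc hc ν m a (a + b)
  have hsum : M / 2 ^ (ν + m) / 2 * (∑ i ∈ Finset.Icc a (a + b), ∑ k ∈ Finset.range (a + b + 1 - i),
      (ν.choose i : ℝ) * (m.choose k : ℝ)) ≤
      ∑ i ∈ Finset.range (a + b + 1), Pop^[m] (fun i => if a ≤ i ∧ i ≤ a + b then 1 else 0) i * c ν i := by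
    have hsub : Finset.Icc a (a + b) ⊆ Finset.range (a + b + 1) := by
      intro k; simp only [Finset.mem_range, Finset.mem_Icc]; omega
    rw [Finset.mul_sum]
    refine le_trans (Finset.sum_le_sum ?_) (Finset.sum_le_sum_of_subset_of_nonneg hsub ?_)
    · intro i hi
      have hi' := Finset.mem_Icc.1 hi
      have p1 := Pop_w_lower m a (a + b) i hi'.1 hi'.2
      have p2 := hpt i hi
      have p3 : 0 ≤ (∑ k ∈ Finset.range (a + b + 1 - i), (m.choose k : ℝ)) / 2 ^ m := by positivity
      have p4 : 0 ≤ M * (ν.choose i : ℝ) / 2 ^ ν / 2 := by positivity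
      refine le_trans (le_of_eq ?_) (mul_le_mul p1 p2 p4 (p3.trans p1))
      rw [← Finset.mul_sum, pow_add]
      field_simp
    · intro i _ _
      apply mul_nonneg _ (hcn _ _)
      rw [Pop_iter]
      apply Finset.sum_nonneg
      intro k _
      split_ifs <;> simp
  set H := ∑ i ∈ Finset.Icc a (a + b), ∑ k ∈ Finset.range (a + b + 1 - i),
      (ν.choose i : ℝ) * (m.choose k : ℝ) with hHdef
  have hHB : B / 160 ≤ H := by linarith
  have hfin : 5 * Real.sqrt m ≤ M / 2 ^ (ν + m) / 2 * H := by
    have : (M:ℝ) / 2 ^ (ν + m) / 2 * (B / 160) ≤ M / 2 ^ (ν + m) / 2 * H := by gcongr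
    refine le_trans ?_ this
    rw [div_div, div_mul_div_comm, le_div_iff₀ (by positivity)]
    linarith
  linarith

lemma eventual (f : ℝ) (h0 : 0 < f) (h1 : f < 1 / 2) (D : ℕ) (ε : ℝ) (hε : 0 < ε) :
    ∀ᶠ n : ℕ in Filter.atTop,
      1 ≤ Real.log n ∧ 0 ≤ Real.log (Real.log n) ∧
      (max 1 (max 6 ((10 * (D : ℝ)) ^ 2) / (f * (1 - f)))) ≤
        (⌊(4 / (1 - 2 * f) ^ 2) * Real.log (Real.log n)⌋₊ : ℝ) ∧
      4 * ((⌊(4 / (1 - 2 * f) ^ 2) * Real.log (Real.log n)⌋₊ : ℝ) + 2) ^ 2 ≤ f * (1 - f) * n ∧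
      8 * (1 + Real.log n) ≤ ε * Real.log n ^ 2 := by
  have hf : 0 < 1 - f := by linarith
  set κ := 4 / (1 - 2 * f) ^ 2 with hκ
  have hκ0 : 0 < κ := by
    have : 0 < 1 - 2 * f := by linarith
    positivity
  have tl : Filter.Tendsto (fun n : ℕ => Real.log n) Filter.atTop Filter.atTop :=
    Real.tendsto_log_atTop.comp tendsto_natCast_atTop_atTop
  have tll : Filter.Tendsto (fun n : ℕ => Real.log (Real.log n)) Filter.atTop Filter.atTop :=
    Real.tendsto_log_atTop.comp tl
  have tk : Filter.Tendsto (fun n : ℕ => κ * Real.log (Real.log n)) Filter.atTop Filter.atTop :=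
    tll.const_mul_atTop hκ0
  have tm : Filter.Tendsto (fun n : ℕ => (⌊κ * Real.log (Real.log n)⌋₊ : ℝ)) Filter.atTop Filter.atTop :=
    tendsto_natCast_atTop_atTop.comp (tendsto_nat_floor_atTop.comp tk)
  have hlo := (Real.isLittleO_pow_log_id_atTop (n := 2)).comp_tendsto
    (tendsto_natCast_atTop_atTop (R := ℝ))
  have hlo' := hlo.def (show 0 < f * (1 - f) / (4 * (κ + 2) ^ 2) by positivity)
  filter_upwards [tl.eventually_ge_atTop (max 1 (16 / ε)), tll.eventually_ge_atTop 0,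
    tm.eventually_ge_atTop (max 1 (max 6 ((10 * (D : ℝ)) ^ 2) / (f * (1 - f)))), hlo'] with n g1 g2 g3 g4
  have g1a := (le_max_left _ _).trans g1
  have g1b := (le_max_right _ _).trans g1
  refine ⟨g1a, g2, g3, ?_, ?_⟩
  · have hm : (⌊κ * Real.log (Real.log n)⌋₊ : ℝ) ≤ κ * Real.log n := by
      refine (Nat.floor_le (by positivity)).trans ?_
      have := Real.log_le_sub_one_of_pos (show 0 < Real.log n by linarith)
      exact mul_le_mul_of_nonneg_left (by linarith) hκ0.le
    have hm2 : (⌊κ * Real.log (Real.log n)⌋₊ : ℝ) + 2 ≤ (κ + 2) * Real.log n := by nlinarith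
    simp only [Function.comp, id, Real.norm_eq_abs, abs_of_nonneg (sq_nonneg (Real.log (n:ℝ))),
      Nat.abs_cast] at g4
    calc _ ≤ 4 * ((κ + 2) * Real.log n) ^ 2 := by gcongr
      _ = (4 * (κ + 2) ^ 2) * Real.log n ^ 2 := by ring
      _ ≤ (4 * (κ + 2) ^ 2) * (f * (1 - f) / (4 * (κ + 2) ^ 2) * n) := by gcongr
      _ = _ := by field_simp
  · rw [div_le_iff₀ hε] at g1b
    nlinarith


theorem liar_machine_survivor_bound :
    ∃ C : ℝ, 0 < C ∧ ∀ f : ℝ, 0 < f → f < 1 / 2 → ∃ N : ℕ, ∀ n : ℕ, N ≤ n →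
      let n₁ := n - ⌊(4 / (1 - 2 * f) ^ 2) * Real.log (Real.log n)⌋₊
      let n₂ := n - n₁
      let Fl := ⌊f * n⌋₊
      let F₁ := ⌊f * (n₁ : ℝ)⌋₊
      ∀ M : ℕ,
        C * Real.sqrt n₂ * 2 ^ n / (∑ i ∈ Finset.range (Fl + 1), (n.choose i : ℝ)) ≤
          (M : ℝ) →
        ∀ F : ℕ → ℤ → ℕ,
          (∀ j : ℤ, F 0 j = if j = 0 then M else 0) →
          IsLiarEvolution F →
          1 ≤ ∑ i ∈ Finset.Icc F₁ Fl, F n (-(n : ℤ) + 2 * (i : ℤ)) := by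
  refine ⟨1600, by norm_num, ?_⟩
  intro f h0 h1
  have hf : 0 < 1 - f := by linarith
  have hff : 0 < f * (1 - f) := by positivity
  have hR : 1 < (1 - f) / f := by rw [lt_div_iff₀ h0]; linarith
  obtain ⟨D0, hD0⟩ := pow_unbounded_of_one_lt (2 : ℝ) hR
  have hD : (2 : ℝ) ≤ ((1 - f) / f) ^ (D0 + 1) :=
    hD0.le.trans (pow_le_pow_right₀ hR.le (by omega))
  have hε : 0 < ((1 - f) / f - 1) * (f / (1 - f)) ^ 2 * Real.exp (-1) / 4 := by
    have : 0 < (1 - f) / f - 1 := by linarith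
    positivity
  obtain ⟨N, hN⟩ := Filter.eventually_atTop.1 (eventual f h0 h1 (D0 + 1) _ hε)
  refine ⟨N, ?_⟩
  intro n hn
  obtain ⟨g1, g2, g3, g4, g5⟩ := hN n hn
  have hx : 0 < 1 - 2 * f := by linarith
  have hfl := Nat.lt_floor_add_one ((4 / (1 - 2 * f) ^ 2) * Real.log (Real.log n))
  generalize ⌊(4 / (1 - 2 * f) ^ 2) * Real.log (Real.log n)⌋₊ = m at *
  have hm1r : (1 : ℝ) ≤ m := (le_max_left _ _).trans g3
  have hm1 : 1 ≤ m := by exact_mod_cast hm1r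
  have hmbig := (le_max_right _ _).trans g3
  rw [div_le_iff₀ hff] at hmbig
  have hnr : (0 : ℝ) ≤ n := by positivity
  have h2m : 2 * (m : ℝ) ≤ n := by nlinarith
  have hmn : m ≤ n := by
    have : (m : ℝ) ≤ n := by linarith
    exact_mod_cast this
  obtain ⟨ν, rfl⟩ : ∃ ν, n = ν + m := ⟨n - m, by omega⟩
  intro n₁ n₂ Fl F₁ M hM F hF0 hF
  have e1 : n₁ = ν := by simp only [n₁]; omega
  have e2 : n₂ = m := by simp only [n₂, e1]; omega
  have f1 : (F₁ : ℝ) ≤ f * ν := by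
    have := Nat.floor_le (show 0 ≤ f * (n₁ : ℝ) by positivity)
    rw [e1] at this; simpa [F₁, e1] using this
  have f2 : f * ν < F₁ + 1 := by
    have := Nat.lt_floor_add_one (f * (n₁ : ℝ))
    rw [e1] at this; simpa [F₁, e1] using this
  have f3 : (Fl : ℝ) ≤ f * ((ν + m : ℕ) : ℝ) := Nat.floor_le (by positivity)
  have f4 : f * ((ν + m : ℕ) : ℝ) < Fl + 1 := Nat.lt_floor_add_one _
  have f5 : F₁ ≤ Fl := by
    apply Nat.floor_le_floor
    rw [e1]
    push_cast
    have : (0 : ℝ) ≤ m := by positivity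
    nlinarith
  rw [e2] at hM
  clear_value F₁ Fl
  clear e1 e2 n₁ n₂
  obtain ⟨b, rfl⟩ : ∃ b, Fl = F₁ + b := ⟨Fl - F₁, by omega⟩
  push_cast at f3 f4 g4 h2m
  have hbm : (b : ℝ) ≤ f * m + 1 := by linarith
  have hres := liar_core f h0 h1 ν m F₁ b (D0 + 1) M (Real.log ((ν + m : ℕ) : ℝ)) f1 f2
    (by
      have hb0 : (0 : ℝ) ≤ b := by positivity
      have hb1 : (b : ℝ) + 1 ≤ m + 2 := by nlinarith
      have : ((b : ℝ) + 1) ^ 2 ≤ (m + 2) ^ 2 := by gcongr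
      have h3 : (ν : ℝ) + m ≤ 2 * ν := by linarith
      have := mul_le_mul_of_nonneg_left h3 hff.le
      linarith)
    (by linarith) hbm (by omega) hD hm1
    ((le_max_left _ _).trans hmbig)
    (by
      apply Real.le_sqrt_of_sq_le
      exact (le_max_right _ _).trans hmbig)
    (by
      apply Real.log_le_log
      · have : (1:ℝ) ≤ ν := by linarith
        linarith
      · push_cast; linarith)
    g1
    (by
      have hx1 : (1 - 2 * f) ^ 2 ≤ 1 := by nlinarith
      have := mul_le_mul_of_nonneg_right hfl.le (by positivity : 0 ≤ (1 - 2 * f) ^ 2 / 2)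
      have e : 4 / (1 - 2 * f) ^ 2 * Real.log (Real.log ((ν + m : ℕ) : ℝ)) * ((1 - 2 * f) ^ 2 / 2) =
        2 * Real.log (Real.log ((ν + m : ℕ) : ℝ)) := by field_simp; ring
      rw [e] at this
      linarith)
    g5 hM _ _ (liar_to_N M F hF0 hF)
    (by
      intro i
      rw [hF0]
      by_cases hi : i = 0 <;> simp [hi])
    (by intro t i; positivity)
  exact_mod_cast hres
end
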